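/- arXiv:2307.01460 — 2 statements merged into one kernel-verified Lean document; each statement's English description precedes it below -/
import Mathlib

section
/- Every graph that has girth 9 and has no odd hole of length at least 11 (that is, every graph in 𝒢₄) is 3-colorable. -/
open SimpleGraph

variable {V : Type*}

/-- The set of internal vertices of a walk from `x` to `y`. -/
def wInterior {G : SimpleGraph V} {x y : V} (P : G.Walk x y) : Set V :=
  {a | a ∈ P.support ∧ a ≠ x ∧ a ≠ y}

/-- `P` is an induced path of `G`. -/
def IsInducedPath (G : SimpleGraph V) {x y : V} (P : G.Walk x y) : Prop :=
  P.IsPath ∧ ∀ a ∈ P.support, ∀ b ∈ P.support, G.Adj a b → s(a, b) ∈ P.edges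

/-- A hole of `G`: an induced cycle of length at least 4. -/
def IsHole (G : SimpleGraph V) {v : V} (w : G.Walk v v) : Prop :=
  w.IsCycle ∧ 4 ≤ w.length ∧
    ∀ a ∈ w.support, ∀ b ∈ w.support, G.Adj a b → s(a, b) ∈ w.edges

/-- An odd hole of `G`. -/
def IsOddHole (G : SimpleGraph V) {v : V} (w : G.Walk v v) : Prop :=
  IsHole G w ∧ Odd w.length

/-- `G` belongs to the family `𝒢ₗ`: it has girth `2l+1` and
no odd hole of length at least `2l+3`. -/
def MemGFam (G : SimpleGraph V) (l : ℕ) : Prop :=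
  G.girth = (2 * l + 1 : ℕ) ∧
    ∀ (v : V) (w : G.Walk v v), IsOddHole G w → w.length < 2 * l + 3

/-- `G` is `k`-vertex-critical. -/
def IsVertexCritical (G : SimpleGraph V) (k : ℕ) : Prop :=
  G.chromaticNumber = k ∧
    ∀ v : V, (G.induce {u | u ≠ v}).chromaticNumber < k

/-- `S` is a vertex cut of `G`: deleting `S` leaves a disconnected graph. -/
def IsVertexCut (G : SimpleGraph V) (S : Set V) : Prop :=
  ¬ (G.induce Sᶜ).Preconnected

/-- `G` has a `K2`-cut. -/
def HasK2Cut (G : SimpleGraph V) : Prop :=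
  ∃ u v : V, G.Adj u v ∧ IsVertexCut G {u, v}

/-- `G` has a `P3`-cut. -/
def HasP3Cut (G : SimpleGraph V) : Prop :=
  ∃ u v w : V, u ≠ w ∧ G.Adj u v ∧ G.Adj v w ∧ ¬ G.Adj u w ∧ IsVertexCut G {u, v, w}

/-- `G` has a 2-edge-cut: two edges whose removal disconnects the graph. -/
def Has2EdgeCut (G : SimpleGraph V) : Prop :=
  ∃ e f : Sym2 V, e ≠ f ∧ e ∈ G.edgeSet ∧ f ∈ G.edgeSet ∧
    ¬ (G.deleteEdges {e, f}).Preconnected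

/-- `Q1`, `Q2` are the two internally disjoint `(x,y)`-paths of the cycle `w`. -/
def ArcsOf (G : SimpleGraph V) {v x y : V} (w : G.Walk v v) (Q1 Q2 : G.Walk x y) : Prop :=
  x ∈ w.support ∧ y ∈ w.support ∧ x ≠ y ∧ Q1.IsPath ∧ Q2.IsPath ∧
    ({a | a ∈ Q1.support} ∩ {a | a ∈ Q2.support} = {x, y}) ∧
    ({e | e ∈ w.edges} = {e | e ∈ Q1.edges} ∪ {e | e ∈ Q2.edges})

/-- `P` is a chordal path of the hole `w`: `w ∪ P` is an induced theta-subgraph of `G`. -/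
def IsChordalPath (G : SimpleGraph V) {v x y : V} (w : G.Walk v v) (P : G.Walk x y) : Prop :=
  IsHole G w ∧ P.IsPath ∧ 2 ≤ P.length ∧ x ∈ w.support ∧ y ∈ w.support ∧ x ≠ y ∧
    (∀ a ∈ wInterior P, a ∉ w.support) ∧
    (∀ a, (a ∈ w.support ∨ a ∈ P.support) → ∀ b, (b ∈ w.support ∨ b ∈ P.support) →
      G.Adj a b → (s(a, b) ∈ w.edges ∨ s(a, b) ∈ P.edges))

/-- `P` is an `(s,t)`-jump over the hole `w`. -/
def IsJump (G : SimpleGraph V) {v s t : V} (w : G.Walk v v) (P : G.Walk s t) : Prop :=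
  IsHole G w ∧ s ∈ w.support ∧ t ∈ w.support ∧ s ≠ t ∧ ¬ G.Adj s t ∧
    IsInducedPath G P ∧ ∀ a ∈ wInterior P, a ∉ w.support

/-- `P` is a local jump over `w` across the interior of the arc `Q1`
(`Q1`, `Q2` being the two arcs of `w` between the ends of `P`). -/
def IsLocalJumpAcross (G : SimpleGraph V) {v s t : V} (w : G.Walk v v)
    (P Q1 Q2 : G.Walk s t) : Prop :=
  IsJump G w P ∧ ArcsOf G w Q1 Q2 ∧
    (∃ a ∈ wInterior Q1, ∃ b ∈ wInterior P, G.Adj a b) ∧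
    (∀ a ∈ wInterior Q2, ∀ b ∈ wInterior P, ¬ G.Adj a b)

/-- `P` is a local jump over `w`. -/
def IsLocalJump (G : SimpleGraph V) {v s t : V} (w : G.Walk v v) (P : G.Walk s t) : Prop :=
  ∃ Q1 Q2 : G.Walk s t, IsLocalJumpAcross G w P Q1 Q2

/-- `P` is a local jump over `w` across one vertex. -/
def IsLocalJumpAcrossOne (G : SimpleGraph V) {v s t : V} (w : G.Walk v v)
    (P : G.Walk s t) : Prop :=
  ∃ Q1 Q2 : G.Walk s t, IsLocalJumpAcross G w P Q1 Q2 ∧ Q1.length = 2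

/-- `P` is a short jump over `w`: no internal vertex of either arc of `w`
has a neighbour among the internal vertices of `P`. -/
def IsShortJump (G : SimpleGraph V) {v s t : V} (w : G.Walk v v) (P : G.Walk s t) : Prop :=
  IsJump G w P ∧
    ∀ a ∈ w.support, a ≠ s → a ≠ t → ∀ b ∈ wInterior P, ¬ G.Adj a b

/-- `P` is a short jump over `w` across the interior of `Q1`, i.e. `P ∪ Q1` is an
odd hole (a jump hole over `w`). -/
def IsShortJumpAcross (G : SimpleGraph V) {v s t : V} (w : G.Walk v v)
    (P Q1 Q2 : G.Walk s t) : Prop :=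
  IsShortJump G w P ∧ ArcsOf G w Q1 Q2 ∧ IsOddHole G (P.append Q1.reverse)

/-- `x` lies in some jump hole over `w`. -/
def InJumpHoleOver (G : SimpleGraph V) {v : V} (w : G.Walk v v) (x : V) : Prop :=
  ∃ (s t : V) (P Q1 Q2 : G.Walk s t),
    IsShortJumpAcross G w P Q1 Q2 ∧ (x ∈ P.support ∨ x ∈ Q1.support)

/-- `a`, `b`, `c`, `d` appear on the cycle `w` in this cyclic order. -/
def CyclicOrder4 (G : SimpleGraph V) {v : V} (w : G.Walk v v) (a b c d : V) : Prop :=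
  ∃ n : ℕ, List.Sublist [a, b, c, d] (w.support.tail.rotate n)

/-- A `K4`-subdivision in `G`: four distinct branch vertices joined by six
internally disjoint paths (the arrises). -/
structure K4Sub (G : SimpleGraph V) where
  u1 : V
  u2 : V
  u3 : V
  u4 : V
  P1 : G.Walk u1 u2
  P2 : G.Walk u3 u4
  Q1 : G.Walk u2 u3
  Q2 : G.Walk u1 u4
  L1 : G.Walk u1 u3
  L2 : G.Walk u2 u4
  hu : List.Nodup [u1, u2, u3, u4]
  hP1 : P1.IsPath
  hP2 : P2.IsPath
  hQ1 : Q1.IsPath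
  hQ2 : Q2.IsPath
  hL1 : L1.IsPath
  hL2 : L2.IsPath
  hP : ∀ a ∈ P1.support, a ∉ P2.support
  hQ : ∀ a ∈ Q1.support, a ∉ Q2.support
  hL : ∀ a ∈ L1.support, a ∉ L2.support

namespace K4Sub

variable {G : SimpleGraph V}

/-- The face cycle `C1 = P1 ∪ Q1 ∪ L1`. -/
def C1 (H : K4Sub G) : G.Walk H.u1 H.u1 := (H.P1.append H.Q1).append H.L1.reverse
/-- The face cycle `C2 = P1 ∪ Q2 ∪ L2`. -/
def C2 (H : K4Sub G) : G.Walk H.u1 H.u1 := (H.P1.append H.L2).append H.Q2.reverse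
/-- The face cycle `C3 = P2 ∪ Q1 ∪ L2`. -/
def C3 (H : K4Sub G) : G.Walk H.u2 H.u2 := (H.Q1.append H.P2).append H.L2.reverse
/-- The face cycle `C4 = C1 △ C2 △ C3 = P2 ∪ Q2 ∪ L1`. -/
def C4 (H : K4Sub G) : G.Walk H.u1 H.u1 := (H.L1.append H.P2).append H.Q2.reverse

/-- The vertex set of the subdivision. -/
def verts (H : K4Sub G) : Set V :=
  {a | a ∈ H.P1.support ∨ a ∈ H.P2.support ∨ a ∈ H.Q1.support ∨
       a ∈ H.Q2.support ∨ a ∈ H.L1.support ∨ a ∈ H.L2.support}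

/-- The edge set of the subdivision. -/
def edges (H : K4Sub G) : Set (Sym2 V) :=
  {e | e ∈ H.P1.edges ∨ e ∈ H.P2.edges ∨ e ∈ H.Q1.edges ∨
       e ∈ H.Q2.edges ∨ e ∈ H.L1.edges ∨ e ∈ H.L2.edges}

end K4Sub

/-- `H` is an odd `K4`-subdivision: all four face cycles are odd holes. -/
def IsOddK4 (G : SimpleGraph V) (H : K4Sub G) : Prop :=
  IsOddHole G H.C1 ∧ IsOddHole G H.C2 ∧ IsOddHole G H.C3 ∧ IsOddHole G H.C4

/-- `G` has an odd `K4`-subdivision. -/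
def HasOddK4 (G : SimpleGraph V) : Prop := ∃ H : K4Sub G, IsOddK4 G H

/-- `H` is a balanced `K4`-subdivision of type `(1,2)`. -/
def IsBalancedK4 (G : SimpleGraph V) (H : K4Sub G) : Prop :=
  IsOddHole G H.C1 ∧ IsOddHole G H.C2 ∧
    IsHole G H.C3 ∧ Even H.C3.length ∧ IsHole G H.C4 ∧ Even H.C4.length ∧
    H.Q1.length = 1 ∧ 2 ≤ H.L2.length

/-- `G` contains a balanced `K4`-subdivision of type `(1,2)`. -/
def HasBalancedK4 (G : SimpleGraph V) : Prop := ∃ H : K4Sub G, IsBalancedK4 G H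

/-- `P` is a direct connection linking the (vertex sets of) two disjoint induced
subgraphs `S1` and `S2`. -/
def IsDirectConnection (G : SimpleGraph V) (S1 S2 : Set V) {v1 v2 : V}
    (P : G.Walk v1 v2) : Prop :=
  IsInducedPath G P ∧ (∀ x ∈ P.support, x ∉ S1 ∧ x ∉ S2) ∧
    (∃ y ∈ S1, G.Adj v1 y) ∧ (∃ y ∈ S2, G.Adj v2 y) ∧
    (∀ x ∈ P.support, (∃ y ∈ S1, G.Adj x y) → x = v1) ∧
    (∀ x ∈ P.support, (∃ y ∈ S2, G.Adj x y) → x = v2)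

/-- `P` is a minimal direct connection linking `S1` and `S2`. -/
def IsMinimalDirectConnection (G : SimpleGraph V) (S1 S2 : Set V) {v1 v2 : V}
    (P : G.Walk v1 v2) : Prop :=
  IsDirectConnection G S1 S2 P ∧
    ∀ (w1 w2 : V) (P' : G.Walk w1 w2), IsDirectConnection G S1 S2 P' →
      (∀ x ∈ P'.support, x ∈ P.support) → ∀ x ∈ P.support, x ∈ P'.support

/-- The first `N` values of `c` form, in this order, a cycle of `G`. -/
structure IsCycleSeq {V : Type*} (G : SimpleGraph V) (N : ℕ) (c : ℕ → V) : Prop where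
  three_le : 3 ≤ N
  ne : ∀ i j, i < j → j < N → c i ≠ c j
  adj : ∀ i, i + 1 < N → G.Adj (c i) (c (i + 1))
  adj_last : G.Adj (c 0) (c (N - 1))

/-- The first `N` values of `c` form, in this order, an induced cycle of `G`. -/
structure IsHoleSeq {V : Type*} (G : SimpleGraph V) (N : ℕ) (c : ℕ → V) : Prop where
  three_le : 3 ≤ N
  ne : ∀ i j, i < j → j < N → c i ≠ c j
  adj_iff : ∀ i j, i < j → j < N → (G.Adj (c i) (c j) ↔ j = i + 1 ∨ (i = 0 ∧ j + 1 = N))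

/-- All cycles have length at least `9`, and odd holes have length exactly `9`. -/
structure HasOnlyNineHoles {V : Type*} (G : SimpleGraph V) : Prop where
  nine_le : ∀ N c, IsCycleSeq G N c → 9 ≤ N
  le_nine : ∀ N c, IsHoleSeq G N c → Odd N → N ≤ 9

theorem IsHoleSeq.isCycleSeq {V : Type*} {G : SimpleGraph V} {N : ℕ} {c : ℕ → V}
    (h : IsHoleSeq G N c) : IsCycleSeq G N c where
  three_le := h.three_le
  ne := h.ne
  adj i hi := (h.adj_iff i (i + 1) (by omega) hi).2 (Or.inl rfl)
  adj_last := by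
    have := h.three_le
    exact (h.adj_iff 0 (N - 1) (by omega) (by omega)).2 (Or.inr ⟨rfl, by omega⟩)

/-- The graph homomorphism from the standard cycle given by a cycle sequence. -/
def IsCycleSeq.hom {V : Type*} {G : SimpleGraph V} {n : ℕ} {c : ℕ → V}
    (h : IsCycleSeq G (n + 3) c) : cycleGraph (n + 3) →g G where
  toFun i := c i
  map_rel' := by
    intro a b hab
    obtain ⟨a, ha⟩ := a
    obtain ⟨b, hb⟩ := b
    wlog hlt : a < b generalizing a b
    · rcases eq_or_ne a b with rfl | hne
      · exact absurd hab (SimpleGraph.irrefl _)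
      · exact (this b hb a ha hab.symm (by omega)).symm
    rw [cycleGraph_adj'] at hab
    simp only [Fin.sub_def] at hab
    rcases hab with hab | hab
    · have h1 : n + 3 - b + a = 1 := by
        rwa [Nat.mod_eq_of_lt (by omega)] at hab
      have h2 : a = 0 := by omega
      have h3 : b = n + 3 - 1 := by omega
      subst h2 h3
      exact h.adj_last
    · have h1 : b = a + 1 := by
        have : n + 3 - a + b = (b - a) + (n + 3) := by omega
        rw [this, Nat.add_mod_right, Nat.mod_eq_of_lt (by omega)] at hab
        omega
      subst h1
      exact h.adj a hb

theorem IsCycleSeq.hom_injective {V : Type*} {G : SimpleGraph V} {n : ℕ} {c : ℕ → V}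
    (h : IsCycleSeq G (n + 3) c) : Function.Injective h.hom := by
  intro a b hab
  rcases lt_trichotomy a b with hlt | rfl | hlt
  · exact absurd hab (h.ne _ _ hlt b.2)
  · rfl
  · exact absurd hab.symm (h.ne _ _ hlt a.2)

theorem IsCycleSeq.girth_le {V : Type*} {G : SimpleGraph V} {N : ℕ} {c : ℕ → V}
    (h : IsCycleSeq G N c) : G.girth ≤ N := by
  obtain ⟨n, rfl⟩ : ∃ n, N = n + 3 := ⟨N - 3, by have := h.three_le; omega⟩
  have hc : ((cycleGraph.cycle n).map h.hom).IsCycle :=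
    (Walk.isCycle_map_iff_of_injective h.hom_injective).2 cycleGraph.isCycle_cycle
  simpa using girth_le_length hc

theorem mem_edges_cycleGraph_cycle {n : ℕ} {a b : ℕ} (ha : a < n + 3) (hb : b < n + 3)
    (h : b = a + 1 ∨ (a = 0 ∧ b + 1 = n + 3)) :
    s((⟨a, ha⟩ : Fin (n + 3)), ⟨b, hb⟩) ∈ (cycleGraph.cycle n).edges := by
  rw [Walk.mk_mem_edges_iff_exists]
  rcases h with rfl | ⟨rfl, hb'⟩
  · refine ⟨n + 3 - (a + 1), by rw [cycleGraph.length_cycle]; omega, ?_⟩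
    rw [cycleGraph.getVert_cycle (by omega), cycleGraph.getVert_cycle (by omega), Sym2.eq_swap]
    congr 2
    · rw [show n + 3 - (n + 3 - (a + 1) + 1) = a by omega, Nat.mod_eq_of_lt ha]
    · rw [show n + 3 - (n + 3 - (a + 1)) = a + 1 by omega, Nat.mod_eq_of_lt hb]
  · refine ⟨0, by simp, ?_⟩
    rw [cycleGraph.getVert_cycle (by omega), cycleGraph.getVert_cycle (by omega)]
    congr 2
    · simp
    · rw [show n + 3 - (0 + 1) = b by omega, Nat.mod_eq_of_lt hb]

theorem IsHoleSeq.exists_isHole {V : Type*} {G : SimpleGraph V} {N : ℕ} {c : ℕ → V}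
    (h : IsHoleSeq G N c) (hN : 4 ≤ N) : ∃ (v : V) (w : G.Walk v v), IsHole G w ∧ w.length = N := by
  obtain ⟨n, rfl⟩ : ∃ n, N = n + 3 := ⟨N - 3, by omega⟩
  refine ⟨_, (cycleGraph.cycle n).map h.isCycleSeq.hom, ⟨?_, by simpa using hN, ?_⟩, by simp⟩
  · exact (Walk.isCycle_map_iff_of_injective h.isCycleSeq.hom_injective).2 cycleGraph.isCycle_cycle
  · intro a ha b hb hab
    rw [Walk.support_map, List.mem_map] at ha hb
    obtain ⟨i, -, rfl⟩ := ha
    obtain ⟨j, -, rfl⟩ := hb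
    rw [Walk.edges_map, List.mem_map]
    rcases lt_trichotomy i j with hlt | rfl | hlt
    · exact ⟨_, mem_edges_cycleGraph_cycle i.2 j.2 ((h.adj_iff _ _ hlt j.2).1 hab), by simp⟩
    · exact absurd hab (SimpleGraph.irrefl _)
    · refine ⟨_, mem_edges_cycleGraph_cycle j.2 i.2 ((h.adj_iff _ _ hlt i.2).1 hab.symm), ?_⟩
      simp [Sym2.eq_swap]

theorem MemGFam.hasOnlyNineHoles {V : Type*} {G : SimpleGraph V} (hG : MemGFam G 4) :
    HasOnlyNineHoles G where
  nine_le N c h := by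
    have := h.girth_le
    rwa [hG.1] at this
  le_nine N c h hodd := by
    by_contra! hlt
    obtain ⟨v, w, hw, hlen⟩ := h.exists_isHole (by omega)
    have := hG.2 v w ⟨hw, by rwa [hlen]⟩
    obtain ⟨k, hk⟩ := hodd
    omega

theorem HasOnlyNineHoles.induce {V : Type*} {G : SimpleGraph V} (hG : HasOnlyNineHoles G)
    (S : Set V) : HasOnlyNineHoles (G.induce S) where
  nine_le N c h := hG.nine_le N (fun i => (c i : V))
    ⟨h.three_le, fun i j hij hj e => h.ne i j hij hj (Subtype.ext e), h.adj, h.adj_last⟩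
  le_nine N c h := hG.le_nine N (fun i => (c i : V))
    ⟨h.three_le, fun i j hij hj e => h.ne i j hij hj (Subtype.ext e), h.adj_iff⟩

/-- A graph that is not `2`-colorable contains an induced odd cycle. -/
theorem exists_isHoleSeq_of_not_colorable_two {V : Type*} {G : SimpleGraph V}
    (h : ¬ G.Colorable 2) : ∃ N c, IsHoleSeq G N c ∧ Odd N := by
  classical
  rw [two_colorable_iff_forall_loop_even] at h
  have hex : ∃ N, Odd N ∧ ∃ (u : V) (w : G.Walk u u), w.length = N := by
    push Not at h
    obtain ⟨u, w, hw⟩ := h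
    exact ⟨_, Nat.not_even_iff_odd.1 hw, u, w, rfl⟩
  obtain ⟨hodd, u, w, hw⟩ := Nat.find_spec hex
  have hmin : ∀ (v : V) (p : G.Walk v v), p.length < w.length → Even p.length := by
    intro v p hp
    rw [hw] at hp
    by_contra hne
    exact Nat.find_min hex hp ⟨Nat.not_even_iff_odd.1 hne, v, p, rfl⟩
  rw [← hw] at hodd
  have hone : w.length ≠ 1 := by
    intro h1
    have := w.adj_getVert_succ (i := 0) (by omega)
    rw [show 0 + 1 = w.length by omega, w.getVert_length, w.getVert_zero] at this
    exact G.irrefl this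
  have hthree : 3 ≤ w.length := by
    obtain ⟨k, hk⟩ := hodd
    omega
  -- the part of `w` between positions `i` and `j`, and the remainder
  have inner : ∀ i j, i < j → j < w.length → ∃ p : G.Walk (w.getVert i) (w.getVert j),
      p.length = j - i := by
    intro i j hij hj
    refine ⟨((w.drop i).take (j - i)).copy rfl ?_, ?_⟩
    · rw [Walk.drop_getVert]
      congr 1
      omega
    · simp only [Walk.length_copy, Walk.take_length, Walk.drop_length]
      omega
  have outer : ∀ i j, i < j → j < w.length → ∃ p : G.Walk (w.getVert j) (w.getVert i),
      p.length = w.length - (j - i) := by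
    intro i j hij hj
    refine ⟨(w.drop j).append (w.take i), ?_⟩
    simp only [Walk.length_append, Walk.take_length, Walk.drop_length]
    omega
  refine ⟨w.length, w.getVert, ⟨hthree, ?_, ?_⟩, hodd⟩
  · intro i j hij hj he
    obtain ⟨p, hp⟩ := inner i j hij hj
    obtain ⟨q, hq⟩ := outer i j hij hj
    have h1 := hmin _ (p.copy rfl he.symm) (by simp only [Walk.length_copy]; omega)
    have h2 := hmin _ (q.copy rfl he) (by simp only [Walk.length_copy]; omega)
    simp only [Walk.length_copy] at h1 h2
    rw [hp] at h1
    rw [hq] at h2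
    rw [Nat.even_iff] at h1 h2
    rw [Nat.odd_iff] at hodd
    omega
  · intro i j hij hj
    constructor
    · intro hadj
      by_contra! hcon
      obtain ⟨p, hp⟩ := inner i j hij hj
      obtain ⟨q, hq⟩ := outer i j hij hj
      have h1 := hmin _ (Walk.cons hadj.symm p) (by
        simp only [Walk.length_cons]
        omega)
      have h2 := hmin _ (Walk.cons hadj q) (by
        simp only [Walk.length_cons]
        omega)
      simp only [Walk.length_cons] at h1 h2
      rw [hp] at h1
      rw [hq] at h2
      rw [Nat.even_iff] at h1 h2
      rw [Nat.odd_iff] at hodd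
      omega
    · rintro (rfl | ⟨rfl, hj'⟩)
      · exact w.adj_getVert_succ (by omega)
      · have := w.adj_getVert_succ (i := j) (by omega)
        rw [hj', w.getVert_length] at this
        rw [w.getVert_zero]
        exact this.symm

theorem IsHoleSeq.rotate {V : Type*} {G : SimpleGraph V} {c : ℕ → V} (h : IsHoleSeq G 9 c)
    (k : ℕ) : IsHoleSeq G 9 (fun i => c ((i + k) % 9)) where
  three_le := h.three_le
  ne i j hij hj := by
    rcases lt_trichotomy ((i + k) % 9) ((j + k) % 9) with hlt | heq | hlt
    · exact h.ne _ _ hlt (by omega)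
    · omega
    · exact (h.ne _ _ hlt (by omega)).symm
  adj_iff i j hij hj := by
    rcases lt_trichotomy ((i + k) % 9) ((j + k) % 9) with hlt | heq | hlt
    · rw [h.adj_iff _ _ hlt (by omega)]
      omega
    · omega
    · rw [G.adj_comm, h.adj_iff _ _ hlt (by omega)]
      omega

/-- A minimal induced subgraph that is not `3`-colorable. -/
structure IsMinimalCounterexample {V : Type*} (G : SimpleGraph V) : Prop where
  hasOnlyNineHoles : HasOnlyNineHoles G
  not_colorable : ¬ G.Colorable 3
  colorable_induce : ∀ S : Set V, S ≠ Set.univ → (G.induce S).Colorable 3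

theorem exists_coloring_of_colorable_induce {V : Type*} {G : SimpleGraph V} {S : Set V}
    (h : (G.induce S).Colorable 3) (x : V) :
    ∃ f : V → Fin 3, f x = 0 ∧ ∀ u ∈ S, ∀ v ∈ S, G.Adj u v → f u ≠ f v := by
  classical
  obtain ⟨C⟩ := h
  let f : V → Fin 3 := fun v => if hv : v ∈ S then C ⟨v, hv⟩ else 0
  refine ⟨fun v => Equiv.swap (f x) 0 (f v), by simp, fun u hu v hv huv => ?_⟩
  rw [Ne, (Equiv.swap (f x) 0).apply_eq_iff_eq]
  simp only [f, hu, hv, dif_pos]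
  exact C.valid (by simpa using huv)

theorem colorable_three_of_induce_compl {V : Type*} {G : SimpleGraph V} {I : Set V}
    (hI : ∀ u ∈ I, ∀ v ∈ I, ¬ G.Adj u v) (h : (G.induce Iᶜ).Colorable 2) : G.Colorable 3 := by
  classical
  obtain ⟨C⟩ := h
  refine ⟨Coloring.mk (fun v => if hv : v ∈ I then (2 : Fin 3) else (C ⟨v, hv⟩).castSucc) ?_⟩
  intro u v huv
  by_cases hu : u ∈ I <;> by_cases hv : v ∈ I
  · exact absurd huv (hI u hu v hv)
  · simp only [hu, hv, dif_pos, dif_neg, not_false_eq_true]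
    exact (Fin.castSucc_lt_last _).ne'
  · simp only [hu, hv, dif_pos, dif_neg, not_false_eq_true]
    exact (Fin.castSucc_lt_last _).ne
  · simp only [hu, hv, dif_neg, not_false_eq_true]
    intro he
    exact C.valid (v := ⟨u, hu⟩) (w := ⟨v, hv⟩) (by simpa using huv)
      (Fin.castSucc_injective _ he)

theorem IsHoleSeq.false_of_two_coloring {V : Type*} {G : SimpleGraph V} {c : ℕ → V}
    (h : IsHoleSeq G 9 c) (f : V → Fin 3) (hf0 : ∀ i, i < 9 → f (c i) ≠ 0)
    (hf : ∀ i j, i < 9 → j < 9 → G.Adj (c i) (c j) → f (c i) ≠ f (c j)) : False := by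
  have hval : ∀ i, i < 9 → 1 ≤ (f (c i)).val ∧ (f (c i)).val ≤ 2 := by
    intro i hi
    have h1 := hf0 i hi
    rw [Ne, Fin.ext_iff] at h1
    have : (0 : Fin 3).val = 0 := rfl
    omega
  have key : ∀ i, i < 9 → ((f (c i)).val + i) % 2 = (f (c 0)).val % 2 := by
    intro i
    induction i with
    | zero => intro _; rfl
    | succ i ih =>
      intro hi
      have h1 := ih (by omega)
      have h2 := hf i (i + 1) (by omega) hi (h.isCycleSeq.adj i hi)
      rw [Ne, Fin.ext_iff] at h2
      have h3 := hval i (by omega)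
      have h4 := hval (i + 1) hi
      omega
  have h1 := key 8 (by omega)
  have h2 := hf 0 8 (by omega) (by omega) h.isCycleSeq.adj_last
  rw [Ne, Fin.ext_iff] at h2
  have h3 := hval 0 (by omega)
  have h4 := hval 8 (by omega)
  omega

theorem HasOnlyNineHoles.seven_le_of_adj_of_adj {V : Type*} {G : SimpleGraph V}
    (hG : HasOnlyNineHoles G) {c : ℕ → V} (hc : IsHoleSeq G 9 c) {x : V}
    (hx : ∀ i, i < 9 → x ≠ c i) (h0 : G.Adj x (c 0)) {j : ℕ} (hj0 : 0 < j) (hj : j < 9)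
    (hxj : G.Adj x (c j)) : 7 ≤ j := by
  have : IsCycleSeq G (j + 2) (fun k => if k = 0 then x else c (k - 1)) := by
    refine ⟨by omega, ?_, ?_, ?_⟩
    · intro a b hab hb
      rcases Nat.eq_zero_or_pos a with rfl | ha
      · simpa [show b ≠ 0 by omega] using hx (b - 1) (by omega)
      · simpa [show a ≠ 0 by omega, show b ≠ 0 by omega] using
          hc.ne (a - 1) (b - 1) (by omega) (by omega)
    · intro a ha
      rcases Nat.eq_zero_or_pos a with rfl | ha0
      · simpa using h0
      · have := hc.isCycleSeq.adj (a - 1) (by omega)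
        rw [show a - 1 + 1 = a by omega] at this
        simpa [show a ≠ 0 by omega] using this
    · simpa using hxj
  have := hG.nine_le _ _ this
  omega

namespace IsMinimalCounterexample

variable {V : Type*} {G : SimpleGraph V}

theorem exists_third_neighbor (hG : IsMinimalCounterexample G) (v a b : V) :
    ∃ w, G.Adj v w ∧ w ≠ a ∧ w ≠ b := by
  classical
  by_contra! hcon
  obtain ⟨f, -, hf⟩ := exists_coloring_of_colorable_induce
    (hG.colorable_induce {v}ᶜ (by simp)) v
  obtain ⟨t, ht⟩ : ∃ t : Fin 3, t ≠ f a ∧ t ≠ f b := by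
    generalize f a = x
    generalize f b = y
    revert x y
    decide
  refine hG.not_colorable ⟨Coloring.mk (Function.update f v t) ?_⟩
  have key : ∀ w, G.Adj v w → t ≠ f w := by
    intro w hw
    by_cases hwa : w = a
    · exact hwa ▸ ht.1
    · exact hcon w hw hwa ▸ ht.2
  intro x y hxy
  by_cases hx : x = v
  · subst hx
    rw [Function.update_self, Function.update_of_ne hxy.ne']
    exact key y hxy
  · by_cases hy : y = v
    · subst hy
      rw [Function.update_self, Function.update_of_ne hx]
      exact (key x hxy.symm).symm
    · rw [Function.update_of_ne hx, Function.update_of_ne hy]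
      exact hf x hx y hy hxy

/-- The closed neighborhood of a vertex does not separate a minimal counterexample. -/
theorem exists_adj_of_partition (hG : IsMinimalCounterexample G) {x : V} {A B : Set V}
    (hA : A.Nonempty) (hB : B.Nonempty) (hAx : ∀ a ∈ A, a ≠ x ∧ ¬ G.Adj x a)
    (hBx : ∀ b ∈ B, b ≠ x ∧ ¬ G.Adj x b) (hAB : ∀ a ∈ A, a ∉ B)
    (hcover : ∀ v, v ∈ A ∨ v ∈ B ∨ v = x ∨ G.Adj x v) : ∃ a ∈ A, ∃ b ∈ B, G.Adj a b := by
  by_contra! hno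
  have side : ∀ S T : Set V, T.Nonempty → (∀ b ∈ T, b ≠ x ∧ ¬ G.Adj x b) → (∀ a ∈ S, a ∉ T) →
      ∃ f : V → Fin 3, f x = 0 ∧
        ∀ u, (u ∈ S ∨ u = x ∨ G.Adj x u) → ∀ v, (v ∈ S ∨ v = x ∨ G.Adj x v) →
          G.Adj u v → f u ≠ f v := by
    intro S T hT hTx hST
    obtain ⟨t, ht⟩ := hT
    have hne : {v | v ∈ S ∨ v = x ∨ G.Adj x v} ≠ Set.univ := by
      intro he
      have : t ∈ {v | v ∈ S ∨ v = x ∨ G.Adj x v} := he ▸ Set.mem_univ t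
      rcases this with h | h | h
      · exact hST t h ht
      · exact (hTx t ht).1 h
      · exact (hTx t ht).2 h
    exact exists_coloring_of_colorable_induce (hG.colorable_induce _ hne) x
  obtain ⟨f, hfx, hf⟩ := side A B hB hBx hAB
  obtain ⟨g, hgx, hg⟩ := side B A hA hAx (fun b hb ha => hAB b ha hb)
  let I : Set V := {v | v = x ∨ (v ∈ A ∧ f v = 0) ∨ (v ∈ B ∧ g v = 0)}
  have hI : ∀ u ∈ I, ∀ v ∈ I, ¬ G.Adj u v := by
    rintro u (rfl | ⟨hu, hu0⟩ | ⟨hu, hu0⟩) v (rfl | ⟨hv, hv0⟩ | ⟨hv, hv0⟩) huv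
    · exact G.irrefl huv
    · exact (hAx v hv).2 huv
    · exact (hBx v hv).2 huv
    · exact (hAx u hu).2 huv.symm
    · exact hf u (Or.inl hu) v (Or.inl hv) huv (hu0.trans hv0.symm)
    · exact hno u hu v hv huv
    · exact (hBx u hu).2 huv.symm
    · exact hno v hv u hu huv.symm
    · exact hg u (Or.inl hu) v (Or.inl hv) huv (hu0.trans hv0.symm)
  have htwo : ¬ (G.induce Iᶜ).Colorable 2 := fun h =>
    hG.not_colorable (colorable_three_of_induce_compl hI h)
  obtain ⟨N, c, hc, hodd⟩ := exists_isHoleSeq_of_not_colorable_two htwo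
  have hN : N = 9 := le_antisymm ((hG.hasOnlyNineHoles.induce _).le_nine N c hc hodd)
    ((hG.hasOnlyNineHoles.induce _).nine_le N c hc.isCycleSeq)
  subst hN
  -- rotate the hole so that it meets the neighborhood of `x` at most in its first vertex
  obtain ⟨d, hd, hdI, hdx⟩ : ∃ d : ℕ → V, IsHoleSeq G 9 d ∧ (∀ i, d i ∉ I) ∧
      ∀ j, 0 < j → j < 9 → ¬ G.Adj x (d j) := by
    have hd : IsHoleSeq G 9 (fun i => (c i : V)) :=
      ⟨hc.three_le, fun i j hij hj e => hc.ne i j hij hj (Subtype.ext e), hc.adj_iff⟩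
    have hxI : ∀ i, x ≠ (c i : V) := fun i he => (c i).2 (Or.inl he.symm)
    by_cases hex : ∃ k, k < 9 ∧ G.Adj x (c k)
    · obtain ⟨k, hk, hxk⟩ := hex
      refine ⟨_, hd.rotate k, fun i => (c _).2, fun j hj0 hj hxj => ?_⟩
      have h1 := hG.hasOnlyNineHoles.seven_le_of_adj_of_adj (hd.rotate k) (fun i _ => hxI _)
        (by simpa [Nat.mod_eq_of_lt hk] using hxk) hj0 hj hxj
      have h2 := hG.hasOnlyNineHoles.seven_le_of_adj_of_adj (hd.rotate (k + j)) (j := 9 - j)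
        (fun i _ => hxI _) (by
          simp only [Nat.zero_add]
          rwa [Nat.add_comm k j]) (by omega) (by omega) (by
          rwa [show (9 - j + (k + j)) % 9 = k by omega])
      omega
    · push Not at hex
      exact ⟨_, hd, fun i => (c i).2, fun j _ hj => hex j hj⟩
  have finish : ∀ (S T : Set V) (f : V → Fin 3), f x = 0 → (∀ v ∈ S, f v = 0 → v ∈ I) →
      (∀ u, (u ∈ S ∨ u = x ∨ G.Adj x u) → ∀ v, (v ∈ S ∨ v = x ∨ G.Adj x v) →
          G.Adj u v → f u ≠ f v) →
      (∀ v, v ∈ S ∨ v ∈ T ∨ v = x ∨ G.Adj x v) → (∀ a ∈ S, ∀ b ∈ T, ¬ G.Adj a b) →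
      d 1 ∈ S → False := by
    intro S T f hfx hSI hf hcov hST h1
    have hne : ∀ i, d i ≠ x := fun i he => hdI i (Or.inl he)
    have hS : ∀ i, i < 8 → d (i + 1) ∈ S := by
      intro i
      induction i with
      | zero => intro _; exact h1
      | succ i ih =>
        intro hi
        have hprev := ih (by omega)
        have hadj := hd.isCycleSeq.adj (i + 1) (by omega)
        rcases hcov (d (i + 1 + 1)) with h | h | h | h
        · exact h
        · exact absurd hadj (hST _ hprev _ h)
        · exact absurd h (hne _)
        · exact absurd h (hdx _ (by omega) (by omega))
    have hall : ∀ i, i < 9 → d i ∈ S ∨ G.Adj x (d i) := by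
      intro i hi
      rcases Nat.eq_zero_or_pos i with rfl | hi0
      · rcases hcov (d 0) with h | h | h | h
        · exact Or.inl h
        · exact absurd (hd.isCycleSeq.adj 0 (by omega)).symm (hST _ h1 _ h)
        · exact absurd h (hne _)
        · exact Or.inr h
      · have := hS (i - 1) (by omega)
        rw [show i - 1 + 1 = i by omega] at this
        exact Or.inl this
    refine hd.false_of_two_coloring f ?_ ?_
    · intro i hi h0
      rcases hall i hi with h | h
      · exact hdI i (hSI _ h h0)
      · exact hf x (Or.inr (Or.inl rfl)) _ (Or.inr (Or.inr h)) h (hfx.trans h0.symm)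
    · intro i j hi hj hij
      refine hf _ ?_ _ ?_ hij
      · exact (hall i hi).imp id Or.inr
      · exact (hall j hj).imp id Or.inr
  rcases hcover (d 1) with h | h | h | h
  · exact finish A B f hfx (fun v hv h0 => Or.inr (Or.inl ⟨hv, h0⟩)) hf hcover hno h
  · refine finish B A g hgx (fun v hv h0 => Or.inr (Or.inr ⟨hv, h0⟩)) hg ?_
      (fun b hb a ha hab => hno a ha b hb hab.symm) h
    intro v
    rcases hcover v with h | h | h
    · exact Or.inr (Or.inl h)
    · exact Or.inl h
    · exact Or.inr (Or.inr h)
  · exact hdI 1 (Or.inl h)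
  · exact hdx 1 (by omega) (by omega) h

end IsMinimalCounterexample

/-- The values `p 0, …, p m` form, in this order, an induced path of `G`. -/
def IsInducedSeq {V : Type*} (G : SimpleGraph V) (m : ℕ) (p : ℕ → V) : Prop :=
  ∀ i j, i < j → j ≤ m → p i ≠ p j ∧ (G.Adj (p i) (p j) ↔ j = i + 1)

/-- `r 0 = x, r 1, …, r ρ = y` is a path from `x ∈ S` to `y ∈ S` whose interior is an induced path
outside `S`, without edges to `S` other than those joining its ends to `x` and `y`. -/
structure IsCleanJump {V : Type*} (G : SimpleGraph V) (S : Set V) (x y : V) (ρ : ℕ)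
    (r : ℕ → V) : Prop where
  two_le : 2 ≤ ρ
  start_eq : r 0 = x
  end_eq : r ρ = y
  not_mem : ∀ i, 0 < i → i < ρ → r i ∉ S
  ne : ∀ i j, 0 < i → i < j → j < ρ → r i ≠ r j
  adj_iff : ∀ i j, 0 < i → i < j → j < ρ → (G.Adj (r i) (r j) ↔ j = i + 1)
  adj_mem_iff : ∀ i, 0 < i → i < ρ → ∀ s ∈ S,
    (G.Adj (r i) s ↔ (i = 1 ∧ s = x) ∨ (i + 1 = ρ ∧ s = y))

theorem exists_last {T : ℕ → Prop} {m : ℕ} (h : ∃ k, k ≤ m ∧ T k) :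
    ∃ k, k ≤ m ∧ T k ∧ ∀ j, k < j → j ≤ m → ¬ T j := by
  classical
  obtain ⟨k, hk, hT⟩ := h
  exact ⟨Nat.findGreatest T m, Nat.findGreatest_le m, Nat.findGreatest_spec hk hT,
    fun j hj hjm => Nat.findGreatest_is_greatest hj hjm⟩

/-- A shortest path inside `W` from the vertices satisfying `P` to those satisfying `Q`. -/
theorem exists_isInducedSeq {V : Type*} {G : SimpleGraph V} {W : Set V} {P Q : V → Prop}
    (h : ∃ m, ∃ p : ℕ → V, (∀ i, i ≤ m → p i ∈ W) ∧ (∀ i, i < m → G.Adj (p i) (p (i + 1))) ∧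
      P (p 0) ∧ Q (p m)) :
    ∃ m, ∃ p : ℕ → V, (∀ i, i ≤ m → p i ∈ W) ∧ IsInducedSeq G m p ∧ P (p 0) ∧ Q (p m) ∧
      (∀ i, 0 < i → i ≤ m → ¬ P (p i)) ∧ ∀ i, i < m → ¬ Q (p i) := by
  classical
  obtain ⟨p, hW, hadj, hP, hQ⟩ := Nat.find_spec h
  have hmin := fun k => Nat.find_min h (m := k)
  generalize Nat.find h = m at *
  -- removing the vertices strictly between positions `i` and `i + d + 1`
  have short : ∀ i d, 0 < d → i + d ≤ m → (i + d = m → Q (p i)) →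
      (i + d < m → G.Adj (p i) (p (i + d + 1))) → False := by
    intro i d hd hidm hend hlink
    refine hmin (m - d) (by omega) ⟨fun k => if k ≤ i then p k else p (k + d), ?_, ?_, ?_, ?_⟩
    · intro k hk
      dsimp only
      split_ifs with hki
      · exact hW _ (by omega)
      · exact hW _ (by omega)
    · intro k hk
      dsimp only
      rcases lt_trichotomy k i with hki | rfl | hki
      · rw [if_pos hki.le, if_pos (by omega)]
        exact hadj _ (by omega)
      · rw [if_pos le_rfl, if_neg (by omega), show k + 1 + d = k + d + 1 by omega]
        exact hlink (by omega)
      · rw [if_neg (by omega), if_neg (by omega), show k + 1 + d = k + d + 1 by omega]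
        exact hadj _ (by omega)
    · simpa using hP
    · dsimp only
      split_ifs with hki
      · rw [show m - d = i by omega]
        exact hend (by omega)
      · rwa [show m - d + d = m by omega]
  refine ⟨m, p, hW, ?_, hP, hQ, ?_, ?_⟩
  · intro i j hij hj
    refine ⟨fun he => short i (j - i) (by omega) (by omega) ?_ ?_, fun hA => ?_, ?_⟩
    · intro hm
      rw [he, show j = m by omega]
      exact hQ
    · intro hm
      rw [he, show i + (j - i) + 1 = j + 1 by omega]
      exact hadj _ (by omega)
    · by_contra hne
      refine short i (j - i - 1) (by omega) (by omega) (by omega) fun _ => ?_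
      rwa [show i + (j - i - 1) + 1 = j by omega]
    · rintro rfl
      exact hadj i (by omega)
  · intro i hi him hPi
    refine hmin (m - i) (by omega) ⟨fun k => p (k + i), ?_, ?_, ?_, ?_⟩
    · exact fun k hk => hW _ (by omega)
    · intro k hk
      dsimp only
      rw [show k + 1 + i = k + i + 1 by omega]
      exact hadj _ (by omega)
    · simpa using hPi
    · dsimp only
      rwa [show m - i + i = m by omega]
  · intro i him hQi
    exact short i (m - i) (by omega) (by omega) (fun _ => hQi) (by omega)

theorem IsInducedSeq.isCleanJump {V : Type*} {G : SimpleGraph V} {m : ℕ} {p : ℕ → V}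
    (hp : IsInducedSeq G m p) {S : Set V} {a b : ℕ} (hab : a ≤ b) (hbm : b ≤ m) {s t : V}
    (hS : ∀ i, a ≤ i → i ≤ b → p i ∉ S)
    (hadj : ∀ i, a ≤ i → i ≤ b → ∀ u ∈ S, (G.Adj (p i) u ↔ (i = a ∧ u = s) ∨ (i = b ∧ u = t))) :
    IsCleanJump G S s t (b - a + 2)
      (fun i => if i = 0 then s else if i ≤ b - a + 1 then p (a + i - 1) else t) where
  two_le := by omega
  start_eq := by simp
  end_eq := by simp
  not_mem i hi hi' := by
    rw [if_neg (by omega), if_pos (by omega)]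
    exact hS _ (by omega) (by omega)
  ne i j hi hij hj := by
    rw [if_neg (by omega), if_pos (by omega), if_neg (by omega), if_pos (by omega)]
    exact (hp _ _ (by omega) (by omega)).1
  adj_iff i j hi hij hj := by
    rw [if_neg (by omega), if_pos (by omega), if_neg (by omega), if_pos (by omega),
      (hp _ _ (by omega) (by omega)).2]
    omega
  adj_mem_iff i hi hi' u hu := by
    rw [if_neg (by omega), if_pos (by omega), hadj _ (by omega) (by omega) u hu,
      show a + i - 1 = a ↔ i = 1 by omega, show a + i - 1 = b ↔ i + 1 = b - a + 2 by omega]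

namespace IsCleanJump

variable {V : Type*} {G : SimpleGraph V} {S : Set V} {x y : V} {ρ : ℕ} {r : ℕ → V}

theorem symm (h : IsCleanJump G S x y ρ r) : IsCleanJump G S y x ρ (fun i => r (ρ - i)) where
  two_le := h.two_le
  start_eq := by simpa using h.end_eq
  end_eq := by simpa using h.start_eq
  not_mem i hi hi' := h.not_mem _ (by omega) (by omega)
  ne i j hi hij hj := (h.ne _ _ (by omega) (by omega) (by omega)).symm
  adj_iff i j hi hij hj := by
    rw [G.adj_comm, h.adj_iff _ _ (by omega) (by omega) (by omega)]
    omega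
  adj_mem_iff i hi hi' s hs := by
    rw [h.adj_mem_iff _ (by omega) (by omega) s hs, or_comm,
      show ρ - i = 1 ↔ i + 1 = ρ by omega, show ρ - i + 1 = ρ ↔ i = 1 by omega]

theorem three_le (h : IsCleanJump G S x y ρ r) (hx : x ∈ S) (hy : y ∈ S) (hxy : x ≠ y)
    (huniq : ∀ v, v ∉ S → ∀ s ∈ S, ∀ t ∈ S, G.Adj v s → G.Adj v t → s = t) : 3 ≤ ρ := by
  by_contra hlt
  have h2 : ρ = 2 := by
    have := h.two_le
    omega
  subst h2
  exact hxy (huniq _ (h.not_mem 1 (by omega) (by omega)) x hx y hy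
    ((h.adj_mem_iff 1 (by omega) (by omega) x hx).2 (Or.inl ⟨rfl, rfl⟩))
    ((h.adj_mem_iff 1 (by omega) (by omega) y hy).2 (Or.inr ⟨rfl, rfl⟩)))

/-- Closing a clean jump by an induced path inside `S` yields an induced cycle. -/
theorem isHoleSeq (h : IsCleanJump G S x y ρ r) {l : ℕ} {q : ℕ → V} (hq : IsInducedSeq G l q)
    (hl : 1 ≤ l) (hqS : ∀ i, i ≤ l → q i ∈ S) (hq0 : q 0 = x) (hql : q l = y) :
    IsHoleSeq G (ρ + l) (fun i => if i ≤ l then q i else r (ρ + l - i)) where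
  three_le := by
    have := h.two_le
    omega
  ne i j hij hj := by
    split_ifs with h1 h2 h2
    · exact (hq i j hij h2).1
    · intro he
      exact h.not_mem _ (by omega) (by omega) (he ▸ hqS i h1)
    · omega
    · exact (h.ne _ _ (by omega) (by omega) (by omega)).symm
  adj_iff i j hij hj := by
    have := h.two_le
    split_ifs with h1 h2 h2
    · rw [(hq i j hij h2).2]
      omega
    · rw [G.adj_comm, h.adj_mem_iff _ (by omega) (by omega) _ (hqS i h1)]
      have e1 : q i = x ↔ i = 0 := by
        rw [← hq0]
        refine ⟨fun he => ?_, fun he => he ▸ rfl⟩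
        by_contra hi
        exact (hq 0 i (by omega) h1).1 he.symm
      have e2 : q i = y ↔ i = l := by
        rw [← hql]
        refine ⟨fun he => ?_, fun he => he ▸ rfl⟩
        by_contra hi
        exact (hq i l (by omega) le_rfl).1 he
      rw [e1, e2]
      omega
    · omega
    · rw [G.adj_comm, h.adj_iff _ _ (by omega) (by omega) (by omega)]
      omega

end IsCleanJump

namespace IsMinimalCounterexample

variable {V : Type*} {G : SimpleGraph V}

theorem not_adj_of_adj_of_adj (hG : HasOnlyNineHoles G) {a b c : V} (hab : G.Adj a b)
    (hac : G.Adj a c) : ¬ G.Adj b c := by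
  intro hbc
  have : IsCycleSeq G 3 (fun i => if i = 0 then a else if i = 1 then b else c) := by
    refine ⟨le_rfl, ?_, ?_, by simpa using hac⟩
    · intro i j hij hj
      interval_cases j <;> interval_cases i <;> simp [hab.ne, hac.ne, hbc.ne]
    · intro i hi
      have : i < 2 := by omega
      interval_cases i <;> simp [hab, hbc]
  have := hG.nine_le _ _ this
  omega

/-- Every vertex `h` having degree two in an induced subgraph is the starting point of a path
escaping from that subgraph. -/
theorem exists_escape (hG : IsMinimalCounterexample G) {S : Set V} {h n₁ n₂ : V} (hS : h ∈ S)
    (h₁ : n₁ ∈ S) (h₂ : n₂ ∈ S) (hadj : ∀ s ∈ S, (G.Adj h s ↔ s = n₁ ∨ s = n₂))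
    (huniq : ∀ v, v ∉ S → ∀ s ∈ S, ∀ t ∈ S, G.Adj v s → G.Adj v t → s = t)
    (hz : ∃ z ∈ S, z ≠ h ∧ z ≠ n₁ ∧ z ≠ n₂) :
    (∃ ρ r, IsCleanJump G S n₁ n₂ ρ r) ∨
    ∃ y ∈ S, y ≠ h ∧ y ≠ n₁ ∧ y ≠ n₂ ∧
      ((∃ ρ r, IsCleanJump G S h y ρ r) ∨
      ∃ n, (n = n₁ ∨ n = n₂) ∧ (∃ ρ r, IsCleanJump G S n y ρ r) ∧
        ∃ ρ r, 9 ≤ ρ ∧ (∀ i, 0 < i → i < ρ → r i ∉ S) ∧ IsCleanJump G (S \ {n}) h y ρ r) := by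
  have hn₁ : G.Adj h n₁ := (hadj _ h₁).2 (Or.inl rfl)
  have hn₂ : G.Adj h n₂ := (hadj _ h₂).2 (Or.inr rfl)
  obtain ⟨r₁, hr₁, hr₁₁, hr₁₂⟩ := hG.exists_third_neighbor h n₁ n₂
  have hr₁S : r₁ ∉ S := fun hr => by
    rcases (hadj _ hr).1 hr₁ with e | e
    · exact hr₁₁ e
    · exact hr₁₂ e
  let W : Set V := {v | v = r₁ ∨ (v ∉ S ∧ ¬ G.Adj h v)}
  let Q : V → Prop := fun v => ∃ y ∈ S, y ≠ h ∧ y ≠ n₁ ∧ y ≠ n₂ ∧ G.Adj v y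
  have hWS : ∀ v ∈ W, v ∉ S := by
    rintro v (rfl | ⟨hv, -⟩)
    · exact hr₁S
    · exact hv
  have hpath : ∃ m, ∃ p : ℕ → V, (∀ i, i ≤ m → p i ∈ W) ∧
      (∀ i, i < m → G.Adj (p i) (p (i + 1))) ∧ p 0 = r₁ ∧ Q (p m) := by
    by_contra! hcon
    let R : Set V := {v | ∃ m, ∃ p : ℕ → V, (∀ i, i ≤ m → p i ∈ W) ∧
      (∀ i, i < m → G.Adj (p i) (p (i + 1))) ∧ p 0 = r₁ ∧ p m = v}
    have hRW : ∀ v ∈ R, v ∈ W := by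
      rintro v ⟨m, p, hp, -, -, rfl⟩
      exact hp m le_rfl
    have hRQ : ∀ v ∈ R, ¬ Q v := by
      rintro v ⟨m, p, hp, hpa, hp0, rfl⟩
      exact hcon m p hp hpa hp0
    have hr₁R : r₁ ∈ R := ⟨0, fun _ => r₁, fun _ _ => Or.inl rfl, by omega, rfl, rfl⟩
    have hstep : ∀ u ∈ R, ∀ v ∈ W, G.Adj u v → v ∈ R := by
      rintro u ⟨m, p, hp, hpa, hp0, rfl⟩ v hv huv
      refine ⟨m + 1, fun i => if i ≤ m then p i else v, ?_, ?_, ?_, ?_⟩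
      · intro i hi
        dsimp only
        split_ifs with him
        · exact hp i him
        · exact hv
      · intro i hi
        dsimp only
        rw [if_pos (by omega)]
        split_ifs with him
        · exact hpa i (by omega)
        · rwa [show i = m by omega]
      · simpa using hp0
      · simp
    obtain ⟨z, hzS, hzh, hz₁, hz₂⟩ := hz
    obtain ⟨w, hw, hwh, -⟩ := hG.exists_third_neighbor r₁ h h
    have hwW : w ∈ W := by
      refine Or.inr ⟨fun hwS => hwh (huniq _ hr₁S _ hwS _ hS hw hr₁.symm), fun hhw => ?_⟩
      exact not_adj_of_adj_of_adj hG.hasOnlyNineHoles hr₁ hhw hw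
    obtain ⟨a, ⟨haR, har⟩, b, ⟨hbA, hbh, hhb⟩, hab⟩ :=
      hG.exists_adj_of_partition (x := h) (A := {v | v ∈ R ∧ v ≠ r₁})
        (B := {v | ¬ (v ∈ R ∧ v ≠ r₁) ∧ v ≠ h ∧ ¬ G.Adj h v})
        ⟨w, hstep _ hr₁R _ hwW hw, hw.ne'⟩
        ⟨z, fun hzR => hWS z (hRW z hzR.1) hzS, hzh, fun hhz => by
          rcases (hadj z hzS).1 hhz with e | e
          · exact hz₁ e
          · exact hz₂ e⟩
        (by
          rintro a ⟨haR, har⟩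
          have haW := hRW a haR
          refine ⟨fun e => hWS a haW (e ▸ hS), ?_⟩
          rcases haW with e | ⟨-, e⟩
          · exact absurd e har
          · exact e)
        (fun b hb => hb.2) (fun a ha hb => hb.1 ha) (by
          intro v
          by_cases h1 : v ∈ R ∧ v ≠ r₁
          · exact Or.inl h1
          · by_cases h2 : v = h
            · exact Or.inr (Or.inr (Or.inl h2))
            · by_cases h3 : G.Adj h v
              · exact Or.inr (Or.inr (Or.inr h3))
              · exact Or.inr (Or.inl ⟨h1, h2, h3⟩))
    by_cases hbS : b ∈ S
    · exact hRQ a haR ⟨b, hbS, hbh, fun e => hhb (e ▸ hn₁), fun e => hhb (e ▸ hn₂), hab⟩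
    · exact hbA ⟨hstep a haR b (Or.inr ⟨hbS, hhb⟩) hab, fun e => hhb (e ▸ hr₁)⟩
  obtain ⟨m, p, hpW, hp, hp0, ⟨y, hyS, hyh, hy₁, hy₂, hpy⟩, hp0', hpQ⟩ :=
    exists_isInducedSeq (P := fun v => v = r₁) hpath
  have hpS : ∀ i, i ≤ m → p i ∉ S := fun i hi => hWS _ (hpW i hi)
  have hph : ∀ i, i ≤ m → (G.Adj (p i) h ↔ i = 0) := by
    intro i hi
    refine ⟨fun hA => ?_, ?_⟩
    · by_contra hne
      rcases hpW i hi with e | ⟨-, e⟩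
      · exact hp0' i (by omega) hi e
      · exact e hA.symm
    · rintro rfl
      exact hp0 ▸ hr₁.symm
  have hpu : ∀ i, i ≤ m → ∀ u ∈ S, u ≠ n₁ → u ≠ n₂ →
      (G.Adj (p i) u ↔ (i = 0 ∧ u = h) ∨ (i = m ∧ u = y)) := by
    intro i hi u hu hu₁ hu₂
    constructor
    · intro hA
      by_cases huh : u = h
      · exact Or.inl ⟨(hph i hi).1 (huh ▸ hA), huh⟩
      · have him : i = m := by
          by_contra hne
          exact hpQ i (by omega) ⟨u, hu, huh, hu₁, hu₂, hA⟩
        subst him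
        exact Or.inr ⟨rfl, huniq _ (hpS i hi) _ hu _ hyS hA hpy⟩
    · rintro (⟨rfl, rfl⟩ | ⟨rfl, rfl⟩)
      · exact (hph 0 hi).2 rfl
      · exact hpy
  have key : ∀ n n', n ∈ S → n' ∈ S → n ≠ h → n' ≠ h → G.Adj h n →
      (∀ i, i ≤ m → ∀ u ∈ S, u ≠ n → u ≠ n' →
        (G.Adj (p i) u ↔ (i = 0 ∧ u = h) ∨ (i = m ∧ u = y))) → y ≠ n → y ≠ n' →
      ∀ k, k ≤ m → G.Adj (p k) n →
        (∀ j, k < j → j ≤ m → ¬ (G.Adj (p j) n ∨ G.Adj (p j) n')) →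
      (∃ ρ r, IsCleanJump G S n' n ρ r) ∨ (∃ ρ r, IsCleanJump G S n y ρ r) ∧
        ∃ ρ r, 9 ≤ ρ ∧ (∀ i, 0 < i → i < ρ → r i ∉ S) ∧ IsCleanJump G (S \ {n}) h y ρ r := by
    intro n n' hn hn' hnh hn'h hhn hpu hyn hyn' k hk hkn hlast
    have hk0 : k ≠ 0 := by
      rintro rfl
      exact hnh (huniq _ (hpS 0 hk) _ hn _ hS hkn ((hph 0 hk).2 rfl))
    have hkm : k ≠ m := by
      rintro rfl
      exact hyn (huniq _ (hpS k hk) _ hyS _ hn hpy hkn)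
    by_cases hex : ∃ i, i ≤ m ∧ G.Adj (p i) n'
    · left
      obtain ⟨a, ham, han, halast⟩ := exists_last hex
      have hak : a ≤ k := by
        by_contra! hlt
        exact hlast a hlt ham (Or.inr han)
      have hex' : ∃ b, a ≤ b ∧ G.Adj (p b) n := ⟨k, hak, hkn⟩
      classical
      obtain ⟨hab, hbn⟩ := Nat.find_spec hex'
      have hbmin := fun c => Nat.find_min hex' (m := c)
      have hbk : Nat.find hex' ≤ k := Nat.find_min' hex' ⟨hak, hkn⟩
      generalize Nat.find hex' = b at *
      have ha0 : a ≠ 0 := by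
        rintro rfl
        exact hn'h (huniq _ (hpS 0 ham) _ hn' _ hS han ((hph 0 ham).2 rfl))
      refine ⟨_, _, hp.isCleanJump (s := n') (t := n) hab (by omega)
        (fun i _ _ => hpS i (by omega)) fun i hai hib u hu => ⟨fun hA => ?_, ?_⟩⟩
      · by_cases e : u = n
        · refine Or.inr ⟨?_, e⟩
          by_contra hne
          exact hbmin i (by omega) ⟨hai, e ▸ hA⟩
        · by_cases e' : u = n'
          · refine Or.inl ⟨?_, e'⟩
            by_contra hne
            exact halast i (by omega) (by omega) (e' ▸ hA)
          · rcases (hpu i (by omega) u hu e e').1 hA with h | h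
            · omega
            · omega
      · rintro (⟨rfl, rfl⟩ | ⟨rfl, rfl⟩)
        · exact han
        · exact hbn
    · right
      push Not at hex
      constructor
      · refine ⟨_, _, hp.isCleanJump (s := n) (t := y) hk le_rfl (fun i _ hi => hpS i hi)
          fun i hki him u hu => ⟨fun hA => ?_, ?_⟩⟩
        · by_cases e : u = n
          · refine Or.inl ⟨?_, e⟩
            by_contra hne
            exact hlast i (by omega) him (Or.inl (e ▸ hA))
          · by_cases e' : u = n'
            · exact absurd (e' ▸ hA) (hex i him)
            · rcases (hpu i him u hu e e').1 hA with h | h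
              · omega
              · exact Or.inr h
        · rintro (⟨rfl, rfl⟩ | ⟨rfl, rfl⟩)
          · exact hkn
          · exact hpy
      · refine ⟨_, _, ?_, ?_, hp.isCleanJump (S := S \ {n}) (s := h) (t := y) (Nat.zero_le m)
          le_rfl (fun i _ hi h => hpS i hi h.1) fun i _ him u hu => ?_⟩
        · have : IsCycleSeq G (k + 3)
              (fun i => if i = 0 then h else if i ≤ k + 1 then p (i - 1) else n) := by
            refine ⟨by omega, ?_, ?_, ?_⟩
            · intro i j hij hj
              rw [if_neg (show j ≠ 0 by omega)]
              by_cases h1 : i = 0 <;> by_cases h2 : j ≤ k + 1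
              · rw [if_pos h1, if_pos h2]
                exact fun e => hpS _ (by omega) (e ▸ hS)
              · rw [if_pos h1, if_neg h2]
                exact hnh.symm
              · rw [if_neg h1, if_pos (by omega), if_pos h2]
                exact (hp _ _ (by omega) (by omega)).1
              · rw [if_neg h1, if_pos (by omega), if_neg h2]
                intro e
                exact hpS (i - 1) (by omega) (e ▸ hn)
            · intro i hi
              rw [if_neg (show i + 1 ≠ 0 by omega)]
              by_cases h1 : i = 0 <;> by_cases h2 : i + 1 ≤ k + 1
              · rw [if_pos h1, if_pos h2]
                subst h1
                exact ((hph 0 (by omega)).2 rfl).symm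
              · omega
              · rw [if_neg h1, if_pos (by omega), if_pos h2]
                exact (hp _ _ (by omega) (by omega)).2.2 (by omega)
              · rw [if_neg h1, if_pos (by omega), if_neg h2]
                rwa [show i - 1 = k by omega]
            · simpa using hhn
          have := hG.hasOnlyNineHoles.nine_le _ _ this
          omega
        · intro i hi0 hi
          rw [if_neg (by omega), if_pos (by omega)]
          exact hpS _ (by omega)
        · by_cases e' : u = n'
          · subst e'
            refine ⟨fun hA => absurd hA (hex i him), ?_⟩
            rintro (⟨rfl, e⟩ | ⟨rfl, e⟩)
            · exact absurd e hn'h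
            · exact absurd e.symm hyn'
          · exact hpu i him u hu.1 hu.2 e'
  by_cases hex : ∃ i, i ≤ m ∧ (G.Adj (p i) n₁ ∨ G.Adj (p i) n₂)
  · obtain ⟨k, hk, hkn, hlast⟩ := exists_last hex
    rcases hkn with hkn | hkn
    · rcases key n₁ n₂ h₁ h₂ hn₁.ne' hn₂.ne' hn₁ hpu hy₁ hy₂ k hk hkn hlast with
        ⟨ρ, r, hr⟩ | hc
      · exact Or.inl ⟨_, _, hr.symm⟩
      · exact Or.inr ⟨y, hyS, hyh, hy₁, hy₂, Or.inr ⟨n₁, Or.inl rfl, hc⟩⟩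
    · rcases key n₂ n₁ h₂ h₁ hn₂.ne' hn₁.ne' hn₂ (fun i hi u hu e e' => hpu i hi u hu e' e)
        hy₂ hy₁ k hk hkn (fun j hj hjm hc => hlast j hj hjm hc.symm) with hc | hc
      · exact Or.inl hc
      · exact Or.inr ⟨y, hyS, hyh, hy₁, hy₂, Or.inr ⟨n₂, Or.inr rfl, hc⟩⟩
  · push Not at hex
    refine Or.inr ⟨y, hyS, hyh, hy₁, hy₂, Or.inl ⟨_, _, hp.isCleanJump (s := h) (t := y)
      (Nat.zero_le m) le_rfl (fun i _ hi => hpS i hi) fun i _ him u hu => ?_⟩⟩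
    by_cases e₁ : u = n₁
    · subst e₁
      refine ⟨fun hA => absurd hA (hex i him).1, ?_⟩
      rintro (⟨-, e⟩ | ⟨-, e⟩)
      · exact absurd e hn₁.ne'
      · exact absurd e.symm hy₁
    · by_cases e₂ : u = n₂
      · subst e₂
        refine ⟨fun hA => absurd hA (hex i him).2, ?_⟩
        rintro (⟨-, e⟩ | ⟨-, e⟩)
        · exact absurd e hn₂.ne'
        · exact absurd e.symm hy₂
      · exact hpu i him u hu e₁ e₂

end IsMinimalCounterexample

/-- Adjacency in the graph on `0, …, nb.length - 1` whose neighbor lists are the entries of `nb`. -/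
def listAdj (nb : List (List ℕ)) (i j : ℕ) : Bool := (nb.getD i []).contains j

/-- `φ` embeds the graph on `0, …, n - 1` with adjacency `A` as an induced subgraph of `G`. -/
structure IsCopy {V : Type*} (G : SimpleGraph V) (n : ℕ) (A : ℕ → ℕ → Bool) (φ : ℕ → V) :
    Prop where
  inj : ∀ i j, i < n → j < n → φ i = φ j → i = j
  adj_iff : ∀ i j, i < n → j < n → (G.Adj (φ i) (φ j) ↔ A i j = true)

/-- The vertices of an induced copy. -/
def copySet {V : Type*} (n : ℕ) (φ : ℕ → V) : Set V := {v | ∃ i, i < n ∧ φ i = v}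

theorem mem_copySet {V : Type*} {n i : ℕ} (φ : ℕ → V) (hi : i < n) : φ i ∈ copySet n φ :=
  ⟨i, hi, rfl⟩

/-- Adjacency after adding a path of length `ρ` from `x` to `y` with interior
`n, …, n + ρ - 2`. -/
def jumpAdj (n : ℕ) (A : ℕ → ℕ → Bool) (x y ρ i j : ℕ) : Bool :=
  if i < n then
    if j < n then A i j else (j == n && i == x) || (j + 2 == n + ρ && i == y)
  else
    if j < n then (i == n && j == x) || (i + 2 == n + ρ && j == y) else j == i + 1 || i == j + 1

theorem IsCopy.jump {V : Type*} {G : SimpleGraph V} {n : ℕ} {A : ℕ → ℕ → Bool} {φ : ℕ → V}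
    (h : IsCopy G n A φ) {x y ρ : ℕ} {r : ℕ → V} (hx : x < n) (hy : y < n)
    (hr : IsCleanJump G (copySet n φ) (φ x) (φ y) ρ r) :
    IsCopy G (n + ρ - 1) (jumpAdj n A x y ρ) (fun i => if i < n then φ i else r (i + 1 - n)) := by
  have h2 := hr.two_le
  have hmem : ∀ i, i < n → φ i ∈ copySet n φ := fun i hi => ⟨i, hi, rfl⟩
  have hadj : ∀ i j, i < n → ¬ j < n → j < n + ρ - 1 → (G.Adj (r (j + 1 - n)) (φ i) ↔
      ((j == n && i == x) || (j + 2 == n + ρ && i == y)) = true) := by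
    intro i j hi hj hj'
    rw [hr.adj_mem_iff _ (by omega) (by omega) _ (hmem i hi)]
    have e1 : φ i = φ x ↔ i = x := ⟨h.inj _ _ hi hx, fun e => e ▸ rfl⟩
    have e2 : φ i = φ y ↔ i = y := ⟨h.inj _ _ hi hy, fun e => e ▸ rfl⟩
    simp only [e1, e2, Bool.or_eq_true, Bool.and_eq_true, beq_iff_eq]
    omega
  constructor
  · intro i j hi hj
    split_ifs with h1 h3 h3
    · exact h.inj _ _ h1 h3
    · exact fun e => absurd (e ▸ hmem i h1) (hr.not_mem _ (by omega) (by omega))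
    · exact fun e => absurd (e ▸ hmem j h3) (hr.not_mem _ (by omega) (by omega))
    · intro e
      rcases lt_trichotomy i j with hij | hij | hij
      · exact absurd e (hr.ne _ _ (by omega) (by omega) (by omega))
      · exact hij
      · exact absurd e.symm (hr.ne _ _ (by omega) (by omega) (by omega))
  · intro i j hi hj
    dsimp only [jumpAdj]
    split_ifs with h1 h3 h3
    · exact h.adj_iff _ _ h1 h3
    · rw [G.adj_comm]
      exact hadj i j h1 h3 hj
    · exact hadj j i h3 h1 hi
    · simp only [Bool.or_eq_true, beq_iff_eq]
      rcases lt_trichotomy i j with hij | rfl | hij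
      · rw [hr.adj_iff _ _ (by omega) (by omega) (by omega)]
        omega
      · simp
      · rw [G.adj_comm, hr.adj_iff _ _ (by omega) (by omega) (by omega)]
        omega

/-- `f` embeds the first graph into the second as an induced subgraph. -/
def checkEmbedding (n : ℕ) (A : ℕ → ℕ → Bool) (m : ℕ) (B : ℕ → ℕ → Bool) (f : List ℕ) : Bool :=
  (List.range n).all fun i => decide (f.getD i 0 < m) &&
    (List.range n).all fun j =>
      (i == j || !(f.getD i 0 == f.getD j 0)) && (A i j == B (f.getD i 0) (f.getD j 0))

theorem IsCopy.comp {V : Type*} {G : SimpleGraph V} {n m : ℕ} {A B : ℕ → ℕ → Bool} {φ : ℕ → V}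
    (h : IsCopy G m B φ) {f : List ℕ} (hf : checkEmbedding n A m B f = true) :
    IsCopy G n A (fun i => φ (f.getD i 0)) := by
  simp only [checkEmbedding, List.all_eq_true, List.mem_range, Bool.and_eq_true,
    decide_eq_true_eq, Bool.or_eq_true, beq_iff_eq, Bool.not_eq_true', beq_eq_false_iff_ne] at hf
  constructor
  · intro i j hi hj e
    have := h.inj _ _ (hf i hi).1 (hf j hj).1 e
    exact ((hf i hi).2 j hj).1.resolve_right fun hne => hne this
  · intro i j hi hj
    rw [((hf i hi).2 j hj).2]
    exact h.adj_iff _ _ (hf i hi).1 (hf j hj).1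

/-- `l` lists the vertices of an induced path from `x` to `y` avoiding the vertices in `avoid`. -/
def checkRoute (n : ℕ) (A : ℕ → ℕ → Bool) (avoid : List ℕ) (x y : ℕ) (l : List ℕ) : Bool :=
  decide (2 ≤ l.length) && (l.getD 0 0 == x && l.getD (l.length - 1) 0 == y) &&
    (List.range l.length).all fun j =>
      (decide (l.getD j 0 < n) && !avoid.contains (l.getD j 0)) &&
        (List.range j).all fun i =>
          !(l.getD i 0 == l.getD j 0) && (A (l.getD i 0) (l.getD j 0) == (j == i + 1))

/-- The induced paths ending in `y` and beginning with the reversal of `path`. -/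
def searchRoutes (nb : List (List ℕ)) (avoid : List ℕ) (y : ℕ) : ℕ → List ℕ → List (List ℕ)
  | 0, _ => []
  | _, [] => []
  | fuel + 1, v :: t => (nb.getD v []).flatMap fun w =>
      if avoid.contains w || t.contains w || t.any (listAdj nb w) then []
      else if w == y then [(w :: v :: t).reverse]
      else searchRoutes nb avoid y fuel (w :: v :: t)

/-- The lengths of induced paths from `x` to `y` avoiding the vertices in `avoid`. -/
def routeLengths (nb : List (List ℕ)) (avoid : List ℕ) (x y : ℕ) : List ℕ :=
  ((searchRoutes nb avoid y nb.length [x]).filter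
    (checkRoute nb.length (listAdj nb) avoid x y)).map fun l => l.length - 1

theorem IsCopy.exists_isInducedSeq_of_mem {V : Type*} {G : SimpleGraph V} {nb : List (List ℕ)}
    {φ : ℕ → V} (h : IsCopy G nb.length (listAdj nb) φ) {avoid : List ℕ} {x y k : ℕ}
    (hk : k ∈ routeLengths nb avoid x y) :
    1 ≤ k ∧ ∃ q : ℕ → V, IsInducedSeq G k q ∧ q 0 = φ x ∧ q k = φ y ∧
      ∀ i, i ≤ k → ∃ j, j < nb.length ∧ j ∉ avoid ∧ φ j = q i := by
  simp only [routeLengths, List.mem_map, List.mem_filter] at hk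
  obtain ⟨l, ⟨-, hl⟩, rfl⟩ := hk
  simp only [checkRoute, List.all_eq_true, List.mem_range, Bool.and_eq_true,
    decide_eq_true_eq, beq_iff_eq, Bool.not_eq_true', beq_eq_false_iff_ne,
    List.contains_eq_mem, decide_eq_false_iff_not] at hl
  obtain ⟨⟨h2, hx, hy⟩, hl⟩ := hl
  refine ⟨by omega, fun i => φ (l.getD i 0), fun i j hij hj => ⟨fun e => ?_, ?_⟩, congrArg φ hx,
    congrArg φ hy, fun i hi => ⟨_, (hl i (by omega)).1.1, (hl i (by omega)).1.2, rfl⟩⟩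
  · exact ((hl j (by omega)).2 i hij).1
      (h.inj _ _ (hl i (by omega)).1.1 (hl j (by omega)).1.1 e)
  · rw [h.adj_iff _ _ (hl i (by omega)).1.1 (hl j (by omega)).1.1, ((hl j (by omega)).2 i hij).2,
      beq_iff_eq]

theorem IsCopy.length_of_isCleanJump {V : Type*} {G : SimpleGraph V} (hG : HasOnlyNineHoles G)
    {nb : List (List ℕ)} {φ : ℕ → V} (h : IsCopy G nb.length (listAdj nb) φ) {avoid : List ℕ}
    {x y k ρ : ℕ} {r : ℕ → V} {S : Set V}
    (hS : ∀ j, j < nb.length → j ∉ avoid → φ j ∈ S)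
    (hr : IsCleanJump G S (φ x) (φ y) ρ r) (hk : k ∈ routeLengths nb avoid x y) :
    1 ≤ k ∧ 9 ≤ ρ + k ∧ ((ρ + k) % 2 = 1 → ρ + k ≤ 9) := by
  obtain ⟨hk1, q, hq, hq0, hqk, hqS⟩ := h.exists_isInducedSeq_of_mem hk
  have hole := hr.isHoleSeq hq hk1 (fun i hi => by
    obtain ⟨j, hj, hja, e⟩ := hqS i hi
    exact e ▸ hS j hj hja) hq0 hqk
  exact ⟨hk1, hG.nine_le _ _ hole.isCycleSeq, fun hodd => hG.le_nine _ _ hole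
    (Nat.odd_iff.2 hodd)⟩

/-- The list contains numbers of both parities. -/
def bothParities (l : List ℕ) : Bool := l.any (fun k => k % 2 == 0) && l.any fun k => k % 2 == 1

theorem exists_odd_add_of_bothParities {l : List ℕ} (h : bothParities l = true) (ρ : ℕ) :
    ∃ k ∈ l, (ρ + k) % 2 = 1 := by
  simp only [bothParities, Bool.and_eq_true, List.any_eq_true, beq_iff_eq] at h
  obtain ⟨⟨a, ha, ha'⟩, b, hb, hb'⟩ := h
  rcases Nat.mod_two_eq_zero_or_one ρ with e | e
  · exact ⟨b, hb, by omega⟩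
  · exact ⟨a, ha, by omega⟩

/-- The claim that adding a path of length `length` between the vertices `source` and `target`
of some graph creates an induced copy of the graph with neighbor lists `sub`. -/
structure JumpCertificate where
  source : ℕ
  target : ℕ
  length : ℕ
  sub : List (List ℕ)
  embedding : List ℕ

/-- Some certificate excludes a jump of length `ρ` between `x` and `y`. -/
def checkCertificates (nb : List (List ℕ)) (certs : List JumpCertificate) (x y ρ : ℕ) : Bool :=
  certs.any fun c => (c.source == x && c.target == y && c.length == ρ) &&
    checkEmbedding c.sub.length (listAdj c.sub) (nb.length + ρ - 1)
      (jumpAdj nb.length (listAdj nb) x y ρ) c.embedding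

theorem IsCopy.not_isCleanJump_of_checkCertificates {V : Type*} {G : SimpleGraph V}
    {nb : List (List ℕ)} {φ : ℕ → V} (h : IsCopy G nb.length (listAdj nb) φ)
    {certs : List JumpCertificate}
    (hcerts : ∀ c ∈ certs, ∀ ψ, ¬ IsCopy G c.sub.length (listAdj c.sub) ψ) {x y ρ : ℕ}
    (hx : x < nb.length) (hy : y < nb.length) (hc : checkCertificates nb certs x y ρ = true)
    (r : ℕ → V) : ¬ IsCleanJump G (copySet nb.length φ) (φ x) (φ y) ρ r := by
  intro hr
  simp only [checkCertificates, List.any_eq_true, Bool.and_eq_true, beq_iff_eq] at hc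
  obtain ⟨c, hc, -, he⟩ := hc
  exact hcerts c hc _ ((h.jump hx hy hr).comp he)

/-- No jump of length at least three between `x` and `y` is possible. -/
def checkDead (nb : List (List ℕ)) (certs : List JumpCertificate) (x y : ℕ) : Bool :=
  bothParities (routeLengths nb [] x y) &&
    (List.range 9).all fun ρ => decide (ρ < 3) ||
      (routeLengths nb [] x y).any (fun k =>
        decide (ρ + k < 9) || ((ρ + k) % 2 == 1 && decide (9 < ρ + k))) ||
      checkCertificates nb certs x y ρ

/-- No jump of length at least three between `x` and `y` is possible. -/
def checkDeadPair (nb : List (List ℕ)) (certs : List JumpCertificate) (x y : ℕ) : Bool :=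
  if x < y then checkDead nb certs x y else checkDead nb certs y x

/-- No vertex is adjacent to two vertices of the graph. -/
def checkUnique (nb : List (List ℕ)) (certs : List JumpCertificate) : Bool :=
  (List.range nb.length).all fun y => (List.range y).all fun x =>
    (routeLengths nb [] x y).any (fun k => decide (k ≤ 6)) ||
    (checkCertificates nb certs x y 2 && (List.range nb.length).all fun z =>
      z == x || z == y || (routeLengths nb [] z x).any (fun k => decide (k ≤ 6)) ||
        (routeLengths nb [] z y).any (fun k => decide (k ≤ 6)))

section

variable {V : Type*} {G : SimpleGraph V} {nb : List (List ℕ)} {φ : ℕ → V}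
  {certs : List JumpCertificate}

theorem IsCopy.not_adj_of_close (hG : HasOnlyNineHoles G)
    (h : IsCopy G nb.length (listAdj nb) φ) {x y : ℕ}
    (hc : (routeLengths nb [] x y).any (fun k => decide (k ≤ 6)) = true) {v : V}
    (hv : v ∉ copySet nb.length φ) (hvx : G.Adj v (φ x)) : ¬ G.Adj v (φ y) := by
  intro hvy
  simp only [List.any_eq_true, decide_eq_true_eq] at hc
  obtain ⟨k, hk, hk6⟩ := hc
  obtain ⟨hk1, q, hq, hq0, hqk, hqS⟩ := h.exists_isInducedSeq_of_mem hk
  have : IsCycleSeq G (k + 2) (fun i => if i ≤ k then q i else v) := by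
    refine ⟨by omega, ?_, ?_, ?_⟩
    · intro i j hij hj
      rw [if_pos (by omega)]
      by_cases hjk : j ≤ k
      · rw [if_pos hjk]
        exact (hq i j hij hjk).1
      · rw [if_neg hjk]
        intro e
        obtain ⟨a, ha, -, e'⟩ := hqS i (by omega)
        exact hv ⟨a, ha, e'.trans e⟩
    · intro i hi
      rw [if_pos (by omega)]
      by_cases hjk : i + 1 ≤ k
      · rw [if_pos hjk]
        exact (hq i (i + 1) (by omega) hjk).2.2 rfl
      · rw [if_neg hjk, show i = k by omega, hqk]
        exact hvy.symm
    · rw [if_pos (Nat.zero_le k), if_neg (by omega), hq0]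
      exact hvx.symm
  have := hG.nine_le _ _ this
  omega

theorem IsCopy.eq_of_checkUnique (hG : HasOnlyNineHoles G)
    (h : IsCopy G nb.length (listAdj nb) φ)
    (hcerts : ∀ c ∈ certs, ∀ ψ, ¬ IsCopy G c.sub.length (listAdj c.sub) ψ)
    (hu : checkUnique nb certs = true) {v : V} (hv : v ∉ copySet nb.length φ) :
    ∀ s ∈ copySet nb.length φ, ∀ t ∈ copySet nb.length φ, G.Adj v s → G.Adj v t → s = t := by
  simp only [checkUnique, List.all_eq_true, List.mem_range, Bool.or_eq_true,
    Bool.and_eq_true, beq_iff_eq] at hu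
  have key : ∀ x y, x < y → y < nb.length → G.Adj v (φ x) → ¬ G.Adj v (φ y) := by
    intro x y hxy hy hvx hvy
    rcases hu y hy x hxy with hc | ⟨hc, hz⟩
    · exact h.not_adj_of_close hG hc hv hvx hvy
    · refine h.not_isCleanJump_of_checkCertificates hcerts (by omega) hy hc
        (fun i => if i = 0 then φ x else if i = 1 then v else φ y)
        ⟨le_rfl, by simp, by simp, ?_, by omega, by omega, ?_⟩
      · intro i hi hi2
        obtain rfl : i = 1 := by omega
        simpa using hv
      · intro i hi hi2 s hs
        obtain rfl : i = 1 := by omega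
        simp only [one_ne_zero, if_false, if_true, true_and, Nat.reduceAdd]
        constructor
        · intro hvs
          obtain ⟨z, hzn, rfl⟩ := hs
          rcases hz z hzn with ((e | e) | hc) | hc
          · exact Or.inl (e ▸ rfl)
          · exact Or.inr (e ▸ rfl)
          · exact absurd hvx (h.not_adj_of_close hG hc hv hvs)
          · exact absurd hvy (h.not_adj_of_close hG hc hv hvs)
        · rintro (rfl | rfl)
          · exact hvx
          · exact hvy
  rintro _ ⟨x, hx, rfl⟩ _ ⟨y, hy, rfl⟩ hvx hvy
  rcases lt_trichotomy x y with hxy | rfl | hxy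
  · exact absurd hvy (key x y hxy hy hvx)
  · rfl
  · exact absurd hvx (key y x hxy hx hvy)

theorem IsCopy.not_isCleanJump_of_checkDead (hG : HasOnlyNineHoles G)
    (h : IsCopy G nb.length (listAdj nb) φ)
    (hcerts : ∀ c ∈ certs, ∀ ψ, ¬ IsCopy G c.sub.length (listAdj c.sub) ψ)
    (hu : checkUnique nb certs = true) {x y : ℕ} (hx : x < nb.length) (hy : y < nb.length)
    (hxy : x ≠ y) (hd : checkDead nb certs x y = true) (ρ : ℕ) (r : ℕ → V) :
    ¬ IsCleanJump G (copySet nb.length φ) (φ x) (φ y) ρ r := by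
  intro hr
  simp only [checkDead, Bool.and_eq_true, List.all_eq_true, List.mem_range, Bool.or_eq_true,
    decide_eq_true_eq, List.any_eq_true, beq_iff_eq] at hd
  have h3 := hr.three_le (mem_copySet φ hx) (mem_copySet φ hy) (fun e => hxy (h.inj _ _ hx hy e))
    fun v hv => h.eq_of_checkUnique hG hcerts hu hv
  have hlen := fun k hk => h.length_of_isCleanJump hG (fun j hj _ => mem_copySet φ hj) hr
    (k := k) (avoid := []) hk
  by_cases h9 : ρ < 9
  · rcases hd.2 ρ h9 with (h3' | ⟨k, hk, hk'⟩) | hc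
    · omega
    · have := hlen k hk
      omega
    · exact h.not_isCleanJump_of_checkCertificates hcerts hx hy hc r hr
  · obtain ⟨k, hk, hk'⟩ := exists_odd_add_of_bothParities hd.1 ρ
    have := hlen k hk
    omega

theorem IsCopy.not_isCleanJump_of_checkDeadPair (hG : HasOnlyNineHoles G)
    (h : IsCopy G nb.length (listAdj nb) φ)
    (hcerts : ∀ c ∈ certs, ∀ ψ, ¬ IsCopy G c.sub.length (listAdj c.sub) ψ)
    (hu : checkUnique nb certs = true) {x y : ℕ} (hx : x < nb.length) (hy : y < nb.length)
    (hxy : x ≠ y) (hd : checkDeadPair nb certs x y = true) (ρ : ℕ) (r : ℕ → V) :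
    ¬ IsCleanJump G (copySet nb.length φ) (φ x) (φ y) ρ r := by
  rw [checkDeadPair] at hd
  split_ifs at hd
  · exact h.not_isCleanJump_of_checkDead hG hcerts hu hx hy hxy hd ρ r
  · exact fun hr => h.not_isCleanJump_of_checkDead hG hcerts hu hy hx hxy.symm hd ρ _ hr.symm

/-- The vertex `v` has exactly the neighbors `a` and `b`, and it is impossible to escape from it. -/
def checkTrapped (nb : List (List ℕ)) (certs : List JumpCertificate) (v a b : ℕ) : Bool :=
  (nb.getD v [] == [a, b] && decide (v < nb.length) && decide (a < nb.length) &&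
    decide (b < nb.length) && !(a == b)) &&
  (List.range nb.length).any (fun z => !(z == v || z == a || z == b)) &&
  checkUnique nb certs && checkDeadPair nb certs a b &&
  (List.range nb.length).all fun y => (y == v || y == a || y == b) ||
    (checkDeadPair nb certs v y &&
      (checkDeadPair nb certs a y || bothParities (routeLengths nb [a] v y)) &&
      (checkDeadPair nb certs b y || bothParities (routeLengths nb [b] v y)))

theorem IsMinimalCounterexample.not_isCopy_of_checkTrapped (hG : IsMinimalCounterexample G)
    (hcerts : ∀ c ∈ certs, ∀ ψ, ¬ IsCopy G c.sub.length (listAdj c.sub) ψ) {v a b : ℕ}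
    (ht : checkTrapped nb certs v a b = true) (φ : ℕ → V) :
    ¬ IsCopy G nb.length (listAdj nb) φ := by
  intro h
  simp only [checkTrapped, Bool.and_eq_true, List.all_eq_true, List.any_eq_true, List.mem_range,
    Bool.or_eq_true, beq_iff_eq, decide_eq_true_eq, Bool.not_eq_true', Bool.or_eq_false_iff,
    beq_eq_false_iff_ne] at ht
  obtain ⟨⟨⟨⟨⟨⟨⟨⟨hnb, hv⟩, ha⟩, hb⟩, hab⟩, z, hz, hzvab⟩, hu⟩, hdab⟩, hdy⟩ := ht
  have hvi : ∀ i, listAdj nb v i = true ↔ i = a ∨ i = b := by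
    intro i
    simp only [listAdj, hnb, List.contains_eq_mem, List.mem_cons, List.not_mem_nil, or_false,
      decide_eq_true_eq]
  have hinj : ∀ i j, i < nb.length → j < nb.length → (φ i = φ j ↔ i = j) :=
    fun i j hi hj => ⟨h.inj i j hi hj, fun e => e ▸ rfl⟩
  have hadj : ∀ s ∈ copySet nb.length φ, (G.Adj (φ v) s ↔ s = φ a ∨ s = φ b) := by
    rintro _ ⟨i, hi, rfl⟩
    rw [h.adj_iff _ _ hv hi, hvi, hinj i a hi ha, hinj i b hi hb]
  have hG9 := hG.hasOnlyNineHoles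
  rcases hG.exists_escape (mem_copySet φ hv) (mem_copySet φ ha) (mem_copySet φ hb) hadj
      (fun w hw => h.eq_of_checkUnique hG9 hcerts hu hw)
      ⟨_, mem_copySet φ hz, by rw [Ne, hinj z v hz hv]; exact hzvab.1.1,
        by rw [Ne, hinj z a hz ha]; exact hzvab.1.2,
        by rw [Ne, hinj z b hz hb]; exact hzvab.2⟩ with
    ⟨ρ, r, hr⟩ | ⟨_, ⟨y, hy, rfl⟩, hyv, hya, hyb, hc⟩
  · exact h.not_isCleanJump_of_checkDeadPair hG9 hcerts hu ha hb hab hdab ρ r hr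
  · rw [Ne, hinj _ _ hy hv] at hyv
    rw [Ne, hinj _ _ hy ha] at hya
    rw [Ne, hinj _ _ hy hb] at hyb
    obtain ⟨⟨hdv, hda⟩, hdb⟩ := (hdy y hy).resolve_left (by simp [hyv, hya, hyb])
    have key : ∀ n, n < nb.length → y ≠ n →
        (checkDeadPair nb certs n y = true ∨ bothParities (routeLengths nb [n] v y) = true) →
        (∃ ρ r, IsCleanJump G (copySet nb.length φ) (φ n) (φ y) ρ r) →
        (∃ ρ r, 9 ≤ ρ ∧ (∀ i, 0 < i → i < ρ → r i ∉ copySet nb.length φ) ∧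
          IsCleanJump G (copySet nb.length φ \ {φ n}) (φ v) (φ y) ρ r) → False := by
      rintro n hn hyn hd ⟨ρ, r, hr⟩ ⟨σ, r', h9, -, hr'⟩
      rcases hd with hd | hd
      · exact h.not_isCleanJump_of_checkDeadPair hG9 hcerts hu hn hy hyn.symm hd ρ r hr
      · obtain ⟨k, hk, hk'⟩ := exists_odd_add_of_bothParities hd σ
        have hS : ∀ j, j < nb.length → j ∉ [n] → φ j ∈ copySet nb.length φ \ {φ n} :=
          fun j hj hjn => ⟨mem_copySet φ hj, fun e => hjn
            (List.mem_singleton.2 (h.inj _ _ hj hn e))⟩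
        have := h.length_of_isCleanJump hG9 hS hr' hk
        omega
    rcases hc with ⟨ρ, r, hr⟩ | ⟨n, rfl | rfl, hr, hr'⟩
    · exact h.not_isCleanJump_of_checkDeadPair hG9 hcerts hu hv hy (Ne.symm hyv) hdv ρ r hr
    · exact key a ha hya hda hr hr'
    · exact key b hb hyb hdb hr hr'

end

/-- The subdivision of `K₄` in which the edges of the three perfect matchings have become paths of
lengths 4, 3, 2. -/
def subdividedTetrahedron432 : List (List ℕ) :=
  [[4, 10, 14], [6, 12, 15], [7, 11, 15], [9, 13, 14], [0, 5], [4, 6], [1, 5], [2, 8], [7, 9],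
   [3, 8], [0, 11], [2, 10], [1, 13], [3, 12], [0, 3], [1, 2]]

/-- The subdivision of `K₄` in which all edges have become paths of length 3. -/
def subdividedTetrahedron333 : List (List ℕ) :=
  [[4, 8, 12], [5, 10, 14], [6, 9, 15], [7, 11, 13], [0, 5], [1, 4], [2, 7], [3, 6], [0, 9],
   [2, 8], [1, 11], [3, 10], [0, 13], [3, 12], [1, 15], [2, 14]]

/-- The subdivision of `K₄` in which the edges of the three perfect matchings have become paths of
lengths 4, 4, 1. -/
def subdividedTetrahedron441 : List (List ℕ) :=
  [[3, 4, 10], [2, 6, 13], [1, 7, 12], [0, 9, 15], [0, 5], [4, 6], [1, 5], [2, 8], [7, 9], [3, 8],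
   [0, 11], [10, 12], [2, 11], [1, 14], [13, 15], [3, 14]]

/-- The graph `theta455` with a path of length 5 added. -/
def theta455Jump : List (List ℕ) :=
  [[2, 5, 9], [4, 8, 12], [0, 3], [2, 4], [1, 3, 16], [0, 6, 13], [5, 7], [6, 8], [1, 7], [0, 10],
   [9, 11], [10, 12], [1, 11], [5, 14], [13, 15], [14, 16], [4, 15]]

/-- Three paths of lengths 4, 5, 5 with common ends. -/
def theta455 : List (List ℕ) :=
  [[2, 5, 9], [4, 8, 12], [0, 3], [2, 4], [1, 3], [0, 6], [5, 7], [6, 8], [1, 7], [0, 10],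
   [9, 11], [10, 12], [1, 11]]

/-- Three paths of lengths 3, 6, 6 with common ends. -/
def theta366 : List (List ℕ) :=
  [[2, 4, 9], [3, 8, 13], [0, 3], [1, 2], [0, 5], [4, 6], [5, 7], [6, 8], [1, 7], [0, 10],
   [9, 11], [10, 12], [11, 13], [1, 12]]

/-- Three paths of lengths 2, 7, 7 with common ends. -/
def theta277 : List (List ℕ) :=
  [[2, 3, 9], [2, 8, 14], [0, 1], [0, 4], [3, 5], [4, 6], [5, 7], [6, 8], [1, 7], [0, 10],
   [9, 11], [10, 12], [11, 13], [12, 14], [1, 13]]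

namespace IsMinimalCounterexample

variable {V : Type*} {G : SimpleGraph V}

theorem not_isCopy_subdividedTetrahedron432 (hG : IsMinimalCounterexample G) (φ : ℕ → V) :
    ¬ IsCopy G subdividedTetrahedron432.length (listAdj subdividedTetrahedron432) φ :=
  hG.not_isCopy_of_checkTrapped (certs := []) (v := 5) (a := 4) (b := 6) (by simp)
    (by decide +kernel) φ

theorem not_isCopy_subdividedTetrahedron333 (hG : IsMinimalCounterexample G) (φ : ℕ → V) :
    ¬ IsCopy G subdividedTetrahedron333.length (listAdj subdividedTetrahedron333) φ :=
  hG.not_isCopy_of_checkTrapped (certs := []) (v := 4) (a := 0) (b := 5) (by simp)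
    (by decide +kernel) φ

theorem not_isCopy_subdividedTetrahedron441 (hG : IsMinimalCounterexample G) (φ : ℕ → V) :
    ¬ IsCopy G subdividedTetrahedron441.length (listAdj subdividedTetrahedron441) φ :=
  hG.not_isCopy_of_checkTrapped (v := 5) (a := 4) (b := 6)
    (certs := [⟨5, 8, 4, subdividedTetrahedron432,
        [0, 2, 8, 5, 10, 11, 12, 18, 17, 16, 3, 9, 1, 6, 4, 7]⟩])
    (by simp [hG.not_isCopy_subdividedTetrahedron432])
    (by decide +kernel) φ

theorem not_isCopy_theta455Jump (hG : IsMinimalCounterexample G) (φ : ℕ → V) :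
    ¬ IsCopy G theta455Jump.length (listAdj theta455Jump) φ :=
  hG.not_isCopy_of_checkTrapped (certs := []) (v := 7) (a := 6) (b := 8) (by simp)
    (by decide +kernel) φ

theorem not_isCopy_theta455 (hG : IsMinimalCounterexample G) (φ : ℕ → V) :
    ¬ IsCopy G theta455.length (listAdj theta455) φ :=
  hG.not_isCopy_of_checkTrapped (v := 6) (a := 5) (b := 7)
    (certs := [⟨4, 5, 5, theta455Jump,
        [0, 1, 2, 3, 4, 5, 6, 7, 8, 9, 10, 11, 12, 16, 15, 14, 13]⟩,
      ⟨5, 12, 4, subdividedTetrahedron441,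
        [0, 12, 1, 5, 9, 10, 11, 8, 7, 6, 2, 3, 4, 15, 14, 13]⟩,
      ⟨6, 11, 4, subdividedTetrahedron432,
        [0, 1, 11, 6, 2, 3, 4, 15, 14, 13, 9, 10, 8, 7, 5, 12]⟩])
    (by simp [hG.not_isCopy_theta455Jump, hG.not_isCopy_subdividedTetrahedron441,
      hG.not_isCopy_subdividedTetrahedron432])
    (by decide +kernel) φ

theorem not_isCopy_theta366 (hG : IsMinimalCounterexample G) (φ : ℕ → V) :
    ¬ IsCopy G theta366.length (listAdj theta366) φ :=
  hG.not_isCopy_of_checkTrapped (v := 6) (a := 5) (b := 7)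
    (certs := [⟨3, 5, 5, theta455,
        [3, 5, 2, 0, 4, 1, 8, 7, 6, 14, 15, 16, 17]⟩,
      ⟨6, 11, 3, subdividedTetrahedron333,
        [0, 11, 1, 6, 9, 10, 8, 7, 2, 3, 15, 14, 4, 5, 12, 13]⟩,
      ⟨2, 7, 5, theta455,
        [2, 7, 3, 1, 8, 0, 4, 5, 6, 14, 15, 16, 17]⟩])
    (by simp [hG.not_isCopy_theta455, hG.not_isCopy_subdividedTetrahedron333])
    (by decide +kernel) φ

theorem not_isCopy_theta277 (hG : IsMinimalCounterexample G) (φ : ℕ → V) :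
    ¬ IsCopy G theta277.length (listAdj theta277) φ :=
  hG.not_isCopy_of_checkTrapped (v := 5) (a := 4) (b := 6)
    (certs := [⟨1, 4, 5, theta455,
        [1, 4, 2, 0, 3, 8, 7, 6, 5, 15, 16, 17, 18]⟩,
      ⟨2, 4, 6, theta366,
        [2, 4, 0, 3, 1, 8, 7, 6, 5, 15, 16, 17, 18, 19]⟩,
      ⟨4, 14, 4, theta455,
        [1, 4, 2, 0, 3, 8, 7, 6, 5, 14, 17, 16, 15]⟩,
      ⟨2, 5, 5, theta455,
        [2, 5, 0, 3, 4, 1, 8, 7, 6, 15, 16, 17, 18]⟩,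
      ⟨2, 6, 5, theta455,
        [2, 6, 1, 8, 7, 0, 3, 4, 5, 15, 16, 17, 18]⟩,
      ⟨5, 12, 2, subdividedTetrahedron432,
        [0, 12, 5, 1, 9, 10, 11, 6, 7, 8, 3, 4, 13, 14, 2, 15]⟩,
      ⟨6, 11, 2, subdividedTetrahedron432,
        [0, 6, 11, 1, 3, 4, 5, 12, 13, 14, 9, 10, 7, 8, 2, 15]⟩])
    (by simp [hG.not_isCopy_theta455, hG.not_isCopy_theta366,
      hG.not_isCopy_subdividedTetrahedron432])
    (by decide +kernel) φ

end IsMinimalCounterexample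

/-- The cycle with nine vertices. -/
def nonagon : List (List ℕ) :=
  [[1, 8], [0, 2], [1, 3], [2, 4], [3, 5], [4, 6], [5, 7], [6, 8], [0, 7]]

section

variable {V : Type*} {G : SimpleGraph V} {c : ℕ → V}

theorem IsHoleSeq.isCopy (hc : IsHoleSeq G 9 c) : IsCopy G nonagon.length (listAdj nonagon) c := by
  have hA : ∀ i < 9, ∀ j < 9, (listAdj nonagon i j = true ↔
      j = i + 1 ∨ i = j + 1 ∨ (i = 0 ∧ j = 8) ∨ (j = 0 ∧ i = 8)) := by decide +kernel
  constructor
  · intro i j hi hj e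
    rcases lt_trichotomy i j with hij | hij | hij
    · exact absurd e (hc.ne _ _ hij hj)
    · exact hij
    · exact absurd e.symm (hc.ne _ _ hij hi)
  · intro i j hi hj
    change i < 9 at hi
    change j < 9 at hj
    rw [hA i hi j hj]
    rcases lt_trichotomy i j with hij | rfl | hij
    · rw [hc.adj_iff _ _ hij hj]
      omega
    · simp only [SimpleGraph.irrefl, false_iff]
      omega
    · rw [G.adj_comm, hc.adj_iff _ _ hij hi]
      omega

theorem IsHoleSeq.eq_of_adj (hG : HasOnlyNineHoles G) (hc : IsHoleSeq G 9 c) {v : V}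
    (hv : v ∉ copySet 9 c) :
    ∀ s ∈ copySet 9 c, ∀ t ∈ copySet 9 c, G.Adj v s → G.Adj v t → s = t :=
  hc.isCopy.eq_of_checkUnique (certs := []) hG (by simp) (by decide +kernel) hv

theorem copySet_rotate (c : ℕ → V) (k : ℕ) :
    copySet 9 (fun i => c ((i + k) % 9)) = copySet 9 c := by
  ext v
  constructor
  · rintro ⟨i, -, rfl⟩
    exact mem_copySet c (Nat.mod_lt _ (by omega))
  · rintro ⟨i, hi, rfl⟩
    refine ⟨(i + 9 - k % 9) % 9, by omega, congrArg c ?_⟩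
    omega

/-- An induced cycle becomes an induced path when one vertex is removed. -/
theorem IsHoleSeq.isInducedSeq {N : ℕ} (hc : IsHoleSeq G N c) {k : ℕ} (hk : k ≤ N) :
    IsInducedSeq G (N - 2) (fun i => if i + k < N then c (i + k) else c (i + k - N)) := by
  have := hc.three_le
  intro i j hij hj
  dsimp only
  split_ifs with h1 h2 h2
  · rw [hc.adj_iff _ _ (by omega) h2]
    exact ⟨hc.ne _ _ (by omega) h2, by omega⟩
  · rw [G.adj_comm, hc.adj_iff _ _ (by omega) h1]
    exact ⟨(hc.ne _ _ (by omega) h1).symm, by omega⟩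
  · omega
  · rw [hc.adj_iff _ _ (by omega) (by omega)]
    exact ⟨hc.ne _ _ (by omega) (by omega), by omega⟩

/-- A path joining the two neighbors of `c a` on the cycle `c` whose interior is disjoint from `c`
and has no other edges to the remaining vertices of `c`, except possibly to `c a`. -/
structure IsBypass (G : SimpleGraph V) (c : ℕ → V) (a σ : ℕ) (r : ℕ → V) : Prop where
  nine_le : 9 ≤ σ
  not_mem : ∀ i, 0 < i → i < σ → r i ∉ copySet 9 c
  isCleanJump : IsCleanJump G (copySet 9 c \ {c (a % 9)}) (c ((a + 8) % 9)) (c ((a + 1) % 9)) σ r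

theorem isBypass_rotate {a k σ : ℕ} {r : ℕ → V} :
    IsBypass G (fun i => c ((i + k) % 9)) a σ r ↔ IsBypass G c (a + k) σ r := by
  have e0 : (a % 9 + k) % 9 = (a + k) % 9 := by omega
  have e1 : ((a + 8) % 9 + k) % 9 = (a + k + 8) % 9 := by omega
  have e2 : ((a + 1) % 9 + k) % 9 = (a + k + 1) % 9 := by omega
  constructor
  · rintro ⟨h1, h2, h3⟩
    rw [copySet_rotate] at h2 h3
    rw [e0, e1, e2] at h3
    exact ⟨h1, h2, h3⟩
  · rintro ⟨h1, h2, h3⟩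
    rw [← e0, ← e1, ← e2] at h3
    rw [← copySet_rotate c k] at h2 h3
    exact ⟨h1, h2, h3⟩

theorem IsHoleSeq.isHoleSeq_of_isBypass (hc : IsHoleSeq G 9 c) {σ : ℕ} {r : ℕ → V}
    (hr : IsBypass G c 1 σ r) : IsHoleSeq G (σ + 7)
      (fun i => if i ≤ 7 then if i + 2 < 9 then c (i + 2) else c (i + 2 - 9)
        else r (σ - (σ + 7 - i))) := by
  refine hr.isCleanJump.symm.isHoleSeq (hc.isInducedSeq (k := 2) (by omega)) (by omega) ?_ rfl rfl
  intro i hi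
  split_ifs with h
  · exact ⟨mem_copySet c h, (hc.ne 1 (i + 2) (by omega) h).symm⟩
  · exact ⟨mem_copySet c (by omega), hc.ne (i + 2 - 9) 1 (by omega) (by omega)⟩

theorem IsHoleSeq.odd_of_isBypass (hG : HasOnlyNineHoles G) (hc : IsHoleSeq G 9 c) {σ : ℕ}
    {r : ℕ → V} (hr : IsBypass G c 1 σ r) : Odd σ := by
  by_contra hodd
  have := hG.le_nine _ _ (hc.isHoleSeq_of_isBypass hr) ((Nat.not_odd_iff_even.1 hodd).add_odd
    (by decide))
  have := hr.nine_le
  omega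

/-- A vertex of a bypass has no neighbors on the cycle other than the bypassed vertex and the two
neighbors of that vertex. -/
theorem IsBypass.eq_of_adj {a σ : ℕ} {r : ℕ → V} (hr : IsBypass G c a σ r) {i : ℕ} (hi : 0 < i)
    (hi' : i < σ) {s : V} (hs : s ∈ copySet 9 c) (hA : G.Adj (r i) s) :
    s = c ((a + 8) % 9) ∨ s = c (a % 9) ∨ s = c ((a + 1) % 9) := by
  by_cases e : s = c (a % 9)
  · exact Or.inr (Or.inl e)
  · rcases (hr.isCleanJump.adj_mem_iff i hi hi' s ⟨hs, e⟩).1 hA with ⟨-, e⟩ | ⟨-, e⟩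
    · exact Or.inl e
    · exact Or.inr (Or.inr e)

end

namespace IsMinimalCounterexample

variable {V : Type*} {G : SimpleGraph V} {c : ℕ → V}

theorem not_isCleanJump_zero (hG : IsMinimalCounterexample G) (hc : IsHoleSeq G 9 c) {y : ℕ}
    (hy : 2 ≤ y) (hy' : y ≤ 7) (ρ : ℕ) (r : ℕ → V) :
    ¬ IsCleanJump G (copySet 9 c) (c 0) (c y) ρ r := by
  refine hc.isCopy.not_isCleanJump_of_checkDead hG.hasOnlyNineHoles
    (certs := [⟨0, 2, 7, theta277, [0, 2, 1, 8, 7, 6, 5, 4, 3, 9, 10, 11, 12, 13, 14]⟩,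
      ⟨0, 3, 6, theta366, [0, 3, 1, 2, 8, 7, 6, 5, 4, 9, 10, 11, 12, 13]⟩,
      ⟨0, 4, 5, theta455, [0, 4, 1, 2, 3, 8, 7, 6, 5, 9, 10, 11, 12]⟩,
      ⟨0, 5, 5, theta455, [0, 5, 8, 7, 6, 1, 2, 3, 4, 9, 10, 11, 12]⟩,
      ⟨0, 6, 6, theta366, [0, 6, 8, 7, 1, 2, 3, 4, 5, 9, 10, 11, 12, 13]⟩,
      ⟨0, 7, 7, theta277, [0, 7, 8, 1, 2, 3, 4, 5, 6, 9, 10, 11, 12, 13, 14]⟩])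
    (by simp [hG.not_isCopy_theta277, hG.not_isCopy_theta366, hG.not_isCopy_theta455])
    (by decide +kernel) (x := 0) (by decide) (show y < 9 by omega) (by omega) ?_ ρ r
  interval_cases y <;> decide +kernel

theorem not_isCleanJump (hG : IsMinimalCounterexample G) (hc : IsHoleSeq G 9 c) {x y : ℕ}
    (hxy : x + 2 ≤ y) (hyx : y ≤ x + 7) (hy : y < 9) (ρ : ℕ) (r : ℕ → V) :
    ¬ IsCleanJump G (copySet 9 c) (c x) (c y) ρ r := by
  have := hG.not_isCleanJump_zero (hc.rotate x) (y := y - x) (by omega) (by omega) ρ r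
  rwa [copySet_rotate, show (0 + x) % 9 = x by omega, show (y - x + x) % 9 = y by omega] at this

theorem exists_isBypass (hG : IsMinimalCounterexample G) (hc : IsHoleSeq G 9 c) :
    (∃ σ r, IsBypass G c 8 σ r) ∨ ∃ σ r, IsBypass G c 1 σ r := by
  have hcopy := hc.isCopy
  have hlt : ∀ {i}, i < 9 → i < nonagon.length := fun hi => hi
  have hinj : ∀ {i j}, i < 9 → j < 9 → (c i = c j ↔ i = j) :=
    fun hi hj => ⟨hcopy.inj _ _ hi hj, fun e => e ▸ rfl⟩
  have hadj : ∀ s ∈ copySet 9 c, (G.Adj (c 0) s ↔ s = c 8 ∨ s = c 1) := by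
    rintro _ ⟨i, hi, rfl⟩
    rw [hcopy.adj_iff _ _ (hlt (by omega)) (hlt hi), hinj hi (by omega), hinj hi (by omega)]
    revert i
    decide +kernel
  rcases hG.exists_escape (mem_copySet c (by omega)) (mem_copySet c (by omega))
      (mem_copySet c (by omega)) hadj (fun v hv => hc.eq_of_adj hG.hasOnlyNineHoles hv)
      ⟨c 2, mem_copySet c (by omega), by rw [Ne, hinj] <;> omega, by rw [Ne, hinj] <;> omega,
        by rw [Ne, hinj] <;> omega⟩ with
    ⟨ρ, r, hr⟩ | ⟨_, ⟨y, hy, rfl⟩, hy0, hy8, hy1, h⟩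
  · exact absurd hr.symm (hG.not_isCleanJump hc (by omega) (by omega) (by omega) _ _)
  · rw [Ne, hinj hy (by omega)] at hy0 hy8 hy1
    rcases h with ⟨ρ, r, hr⟩ | ⟨n, rfl | rfl, ⟨ρ, r, hr⟩, σ, r', h9, hr', hj⟩
    · exact absurd hr (hG.not_isCleanJump hc (by omega) (by omega) hy _ _)
    · by_cases hy7 : y = 7
      · subst hy7
        refine Or.inl ⟨σ, fun i => r' (σ - i), h9, fun i hi hi' => ?_, hj.symm⟩
        exact hr' _ (by omega) (by omega)
      · exact absurd hr.symm (hG.not_isCleanJump hc (by omega) (by omega) (by omega) _ _)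
    · by_cases hy2 : y = 2
      · subst hy2
        exact Or.inr ⟨σ, r', h9, hr', hj⟩
      · exact absurd hr (hG.not_isCleanJump hc (by omega) (by omega) hy _ _)

/-- Two bypasses in opposite position are neither joined by an edge nor do they intersect. -/
theorem not_adj_of_isBypass (hG : IsMinimalCounterexample G) (hc : IsHoleSeq G 9 c)
    {σ τ : ℕ} {r s : ℕ → V} (hr : IsBypass G c 1 σ r) (hs : IsBypass G c 5 τ s) {i j : ℕ}
    (hi : 0 < i) (hi' : i < σ) (hj : 0 < j) (hj' : j < τ) : r i ≠ s j ∧ ¬ G.Adj (r i) (s j) := by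
  by_contra hcon
  have hr2 := hr.isCleanJump
  have hs2 := hs.isCleanJump
  norm_num at hr2 hs2
  have hr9 := hr.nine_le
  have hs9 := hs.nine_le
  have hmem : ∀ {a}, a < 9 → c a ∈ copySet 9 c := fun ha => mem_copySet c ha
  let W : Set V := {v | (∃ i, 0 < i ∧ i < σ ∧ r i = v) ∨ ∃ i, 0 < i ∧ i < τ ∧ s i = v}
  let P : V → Prop := fun v => ∃ a, a ≤ 2 ∧ G.Adj v (c a)
  let Q : V → Prop := fun v => ∃ a, 4 ≤ a ∧ a ≤ 6 ∧ G.Adj v (c a)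
  have hW : ∀ v ∈ W, v ∉ copySet 9 c := by
    rintro _ (⟨i, hi, hi', rfl⟩ | ⟨i, hi, hi', rfl⟩)
    · exact hr.not_mem i hi hi'
    · exact hs.not_mem i hi hi'
  have hWadj : ∀ v ∈ W, ∀ u ∈ copySet 9 c, G.Adj v u → P v ∨ Q v := by
    rintro _ (⟨i, hi, hi', rfl⟩ | ⟨i, hi, hi', rfl⟩) u hu hA
    · left
      rcases hr.eq_of_adj hi hi' hu hA with e | e | e
      · exact ⟨0, by omega, e ▸ hA⟩
      · exact ⟨1, by omega, e ▸ hA⟩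
      · exact ⟨2, by omega, e ▸ hA⟩
    · right
      rcases hs.eq_of_adj hi hi' hu hA with e | e | e
      · exact ⟨4, by omega, by omega, e ▸ hA⟩
      · exact ⟨5, by omega, by omega, e ▸ hA⟩
      · exact ⟨6, by omega, by omega, e ▸ hA⟩
  have hP : P (r 1) := ⟨0, by omega, (hr2.adj_mem_iff 1 (by omega) (by omega) _
    ⟨hmem (by omega), hc.ne 0 1 (by omega) (by omega)⟩).2 (Or.inl ⟨rfl, rfl⟩)⟩
  have hQ : Q (s (τ - 1)) := ⟨6, by omega, by omega, (hs2.adj_mem_iff (τ - 1) (by omega) (by omega)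
    _ ⟨hmem (by omega), (hc.ne 5 6 (by omega) (by omega)).symm⟩).2
      (Or.inr ⟨by omega, rfl⟩)⟩
  have hpath : ∃ m, ∃ p : ℕ → V, (∀ i, i ≤ m → p i ∈ W) ∧
      (∀ i, i < m → G.Adj (p i) (p (i + 1))) ∧ P (p 0) ∧ Q (p m) := by
    have hradj : ∀ k, 0 < k → k + 1 < σ → G.Adj (r k) (r (k + 1)) := fun k hk hk' =>
      (hr2.adj_iff k (k + 1) hk (by omega) hk').2 rfl
    have hsadj : ∀ k, 0 < k → k + 1 < τ → G.Adj (s k) (s (k + 1)) := fun k hk hk' =>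
      (hs2.adj_iff k (k + 1) hk (by omega) hk').2 rfl
    have hjoin : ∃ b, 0 < b ∧ b ≤ τ ∧ (b = τ → Q (r i)) ∧ (b < τ → G.Adj (r i) (s b)) := by
      by_cases e : r i = s j
      · refine ⟨j + 1, by omega, by omega, fun hjτ => ?_, fun hjτ => e ▸ hsadj j hj hjτ⟩
        rw [e, show j = τ - 1 by omega]
        exact hQ
      · refine ⟨j, hj, hj'.le, by omega, fun _ => ?_⟩
        by_contra hA
        exact hcon ⟨e, hA⟩
    obtain ⟨b, hb, hbτ, hbQ, hbA⟩ := hjoin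
    refine ⟨i + τ - b - 1, fun k => if k < i then r (k + 1) else s (b + k - i), ?_, ?_, ?_, ?_⟩
    · intro k hk
      dsimp only
      split_ifs with hki
      · exact Or.inl ⟨_, by omega, by omega, rfl⟩
      · exact Or.inr ⟨_, by omega, by omega, rfl⟩
    · intro k hk
      dsimp only
      by_cases hki : k + 1 < i
      · rw [if_pos (by omega), if_pos hki]
        exact hradj _ (by omega) (by omega)
      · rw [if_neg hki]
        by_cases hki' : k < i
        · rw [if_pos hki', show k + 1 = i by omega, show b + i - i = b by omega]
          exact hbA (by omega)
        · rw [if_neg hki', show b + (k + 1) - i = b + k - i + 1 by omega]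
          exact hsadj _ (by omega) (by omega)
    · simpa [hi] using hP
    · dsimp only
      split_ifs with hki
      · rw [show i + τ - b - 1 + 1 = i by omega]
        exact hbQ (by omega)
      · rw [show b + (i + τ - b - 1) - i = τ - 1 by omega]
        exact hQ
  obtain ⟨m, p, hpW, hp, ⟨a, ha, hpa⟩, ⟨b, hb, hb', hpb⟩, hpP, hpQ⟩ := exists_isInducedSeq hpath
  have huniq := fun i hi => hc.eq_of_adj hG.hasOnlyNineHoles (hW _ (hpW i hi))
  refine hG.not_isCleanJump hc (x := a) (y := b) (by omega) (by omega) (by omega) _ _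
    (hp.isCleanJump (s := c a) (t := c b) (Nat.zero_le m) le_rfl (fun i _ hi => hW _ (hpW i hi))
      fun i _ hi u hu => ⟨fun hA => ?_, ?_⟩)
  · rcases hWadj _ (hpW i hi) u hu hA with hPi | hQi
    · have h0 : i = 0 := by
        by_contra hne
        exact hpP i (by omega) hi hPi
      subst h0
      exact Or.inl ⟨rfl, huniq 0 hi u hu _ (hmem (by omega)) hA hpa⟩
    · have hm : i = m := by
        by_contra hne
        exact hpQ i (by omega) hQi
      subst hm
      exact Or.inr ⟨rfl, huniq i hi u hu _ (hmem (by omega)) hA hpb⟩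
  · rintro (⟨rfl, rfl⟩ | ⟨rfl, rfl⟩)
    · exact hpa
    · exact hpb

theorem not_isBypass_and_isBypass (hG : IsMinimalCounterexample G) (hc : IsHoleSeq G 9 c)
    {σ τ : ℕ} {r s : ℕ → V} (hr : IsBypass G c 1 σ r) (hs : IsBypass G c 5 τ s) : False := by
  have hs' : IsBypass G (fun i => c ((i + 4) % 9)) 1 τ s := isBypass_rotate.2 hs
  have hσ := hc.odd_of_isBypass hG.hasOnlyNineHoles hr
  have hτ := (hc.rotate 4).odd_of_isBypass hG.hasOnlyNineHoles hs'
  have hpath := ((hc.rotate 4).isHoleSeq_of_isBypass hs').isInducedSeq (k := 5) (by omega)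
  have hr9 := hr.nine_le
  have hr2 := hr.isCleanJump.symm
  norm_num at hr2
  have hnot := fun i j hi hi' hj hj' =>
    hG.not_adj_of_isBypass hc hr hs (i := i) (j := j) hi hi' hj hj'
  have hjump : IsCleanJump G (copySet 9 c \ {c 1} ∪ {v | ∃ j, 0 < j ∧ j < τ ∧ s j = v})
      (c 2) (c 0) σ (fun i => r (σ - i)) := by
    refine ⟨hr2.two_le, hr2.start_eq, hr2.end_eq, ?_, hr2.ne, hr2.adj_iff, ?_⟩
    · rintro i hi hi' (h | ⟨j, hj, hj', e⟩)
      · exact hr2.not_mem i hi hi' h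
      · exact (hnot _ _ (by omega) (by omega) hj hj').1 e.symm
    · rintro i hi hi' _ (h | ⟨j, hj, hj', rfl⟩)
      · exact hr2.adj_mem_iff i hi hi' _ h
      · refine ⟨fun hA => absurd hA (hnot _ _ (by omega) (by omega) hj hj').2, ?_⟩
        rintro (⟨-, e⟩ | ⟨-, e⟩)
        · exact absurd (e ▸ mem_copySet c (by omega)) (hs.not_mem j hj hj')
        · exact absurd (e ▸ mem_copySet c (by omega)) (hs.not_mem j hj hj')
  have hole := hjump.isHoleSeq hpath (by omega) ?_ ?_ ?_
  · have := hG.hasOnlyNineHoles.le_nine _ _ hole (by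
      obtain ⟨k, rfl⟩ := hσ
      obtain ⟨l, rfl⟩ := hτ
      exact ⟨k + l + 3, by omega⟩)
    omega
  · have hmem : ∀ a, a < 9 → a ≠ 1 → c a ∈ copySet 9 c \ {c 1} := fun a ha ha1 =>
      ⟨mem_copySet c ha, fun e => ha1 (hc.isCopy.inj _ _ ha (by decide) e)⟩
    intro i hi
    split_ifs with h1 h2 h3 h3
    all_goals first
      | exact Or.inl (hmem _ (by omega) (by omega))
      | exact Or.inr ⟨_, by omega, by omega, rfl⟩
  · have hτ0 := hs.nine_le
    rw [if_pos (by omega)]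
    simp
  · have hτ0 := hs.nine_le
    rw [if_neg (by omega), if_pos (by omega), if_pos (by omega)]
    congr 1
    omega

theorem not_isHoleSeq_nine (hG : IsMinimalCounterexample G) : ¬ IsHoleSeq G 9 c := by
  intro hc
  let B : ℕ → Prop := fun a => ∃ σ r, IsBypass G c a σ r
  have hper : ∀ a, B (a + 9) ↔ B a := by
    intro a
    have e1 : (a + 9 + 8) % 9 = (a + 8) % 9 := by omega
    have e2 : (a + 9 + 1) % 9 = (a + 1) % 9 := by omega
    constructor
    · rintro ⟨σ, r, h1, h2, h3⟩
      rw [Nat.add_mod_right, e1, e2] at h3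
      exact ⟨σ, r, h1, h2, h3⟩
    · rintro ⟨σ, r, h1, h2, h3⟩
      rw [← e1, ← e2, ← Nat.add_mod_right] at h3
      exact ⟨σ, r, h1, h2, h3⟩
  have hB : ∀ k, B (8 + k) ∨ B (1 + k) := by
    intro k
    rcases hG.exists_isBypass (hc.rotate k) with ⟨σ, r, h⟩ | ⟨σ, r, h⟩
    · exact Or.inl ⟨σ, r, isBypass_rotate.1 h⟩
    · exact Or.inr ⟨σ, r, isBypass_rotate.1 h⟩
  have hno : ∀ k, ¬ (B (1 + k) ∧ B (5 + k)) := by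
    rintro k ⟨⟨σ, r, h⟩, τ, s, h'⟩
    exact hG.not_isBypass_and_isBypass (hc.rotate k) (isBypass_rotate.2 h) (isBypass_rotate.2 h')
  have key : ∀ b : Fin 9 → Bool, (∀ k, b (8 + k) = true ∨ b (1 + k) = true) →
      ∃ k, b (1 + k) = true ∧ b (5 + k) = true := by decide +kernel
  classical
  have hmod : ∀ a k : Fin 9, B (a + k : Fin 9) ↔ B (a + k : ℕ) := by
    intro a k
    rw [Fin.val_add]
    by_cases h : (a : ℕ) + k < 9
    · rw [Nat.mod_eq_of_lt h]
    · rw [← hper, show ((a : ℕ) + k) % 9 + 9 = a + k by omega]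
  obtain ⟨k, h1, h5⟩ := key (fun i => decide (B i)) fun k => by
    simp only [decide_eq_true_eq, hmod]
    exact hB k
  simp only [decide_eq_true_eq, hmod] at h1 h5
  exact hno k ⟨h1, h5⟩

end IsMinimalCounterexample

theorem IsMinimalCounterexample.false {V : Type*} {G : SimpleGraph V}
    (hG : IsMinimalCounterexample G) : False := by
  obtain ⟨N, c, hc, hN⟩ := exists_isHoleSeq_of_not_colorable_two
    (fun h => hG.not_colorable (h.mono (by omega)))
  have h1 := hG.hasOnlyNineHoles.nine_le _ _ hc.isCycleSeq
  have h2 := hG.hasOnlyNineHoles.le_nine _ _ hc hN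
  obtain rfl : N = 9 := by omega
  exact hG.not_isHoleSeq_nine hc

theorem HasOnlyNineHoles.colorable_three {V : Type*} [Finite V] {G : SimpleGraph V}
    (hG : HasOnlyNineHoles G) : G.Colorable 3 := by
  by_contra hcon
  have huniv : ¬ (G.induce Set.univ).Colorable 3 := fun h =>
    hcon (h.of_hom (SimpleGraph.induceUnivIso G).symm.toHom)
  obtain ⟨S, hS, hmin⟩ := exists_minimal_of_wellFoundedLT
    (fun S : Set V => ¬ (G.induce S).Colorable 3) ⟨_, huniv⟩
  refine IsMinimalCounterexample.false (G := G.induce S) ⟨hG.induce S, hS, fun T hT => ?_⟩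
  by_contra hcol
  have hTS : Subtype.val '' T ⊆ S := Subtype.coe_image_subset S T
  have himage : ¬ (G.induce (Subtype.val '' T)).Colorable 3 := fun h => hcol <| h.of_hom
    (⟨fun v => ⟨v.1.1, v.1, v.2, rfl⟩, fun h => h⟩ :
      (G.induce S).induce T →g G.induce (Subtype.val '' T))
  refine hT (Set.eq_univ_of_forall fun v => ?_)
  obtain ⟨w, hw, hwv⟩ := hmin himage hTS v.2
  rwa [← Subtype.ext hwv]

/-- Every graph of girth 9 with no odd hole of length at least 11
(i.e. every graph in `𝒢₄`) is 3-colorable. -/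
theorem every_graph_in_G4_is_three_colorable {V : Type*} [Fintype V]
    (G : SimpleGraph V) (hG : MemGFam G 4) : G.Colorable 3 :=
  hG.hasOnlyNineHoles.colorable_three
end

section
/- Let l ≥ 4 be an integer, let G ∈ 𝒢_l and let C be an odd hole of G. If P is a local (v1, v2)-jump over C, then the induced subgraph G[V(C ∪ P)] contains a local jump over C across one vertex or a short jump over C. -/
open SimpleGraph

variable {V : Type*}

namespace SimpleGraph.Walk

variable {G : SimpleGraph V}

/-- In a path, the two parts of a decomposition share only the junction vertex. -/
theorem IsPath.eq_of_mem_support_append {x y z a : V} {A : G.Walk x y} {B : G.Walk y z}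
    (h : (A.append B).IsPath) (hA : a ∈ A.support) (hB : a ∈ B.support) : a = y := by
  by_contra hne
  exact h.ne_of_mem_support_of_append hne hA hB rfl

theorem isInducedPath_reverse {x y : V} {A : G.Walk x y} (h : IsInducedPath G A) :
    IsInducedPath G A.reverse := by
  refine ⟨h.1.reverse, fun a ha b hb hab => ?_⟩
  simp only [support_reverse, List.mem_reverse, edges_reverse] at *
  exact h.2 a ha b hb hab

theorem isInducedPath_of_append_left {x y z : V} {A : G.Walk x y} {B : G.Walk y z}
    (h : IsInducedPath G (A.append B)) : IsInducedPath G A := by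
  refine ⟨h.1.of_append_left, fun a ha b hb hab => ?_⟩
  have he := h.2 a (by simp [mem_support_append_iff, ha]) b
    (by simp [mem_support_append_iff, hb]) hab
  rw [edges_append, List.mem_append] at he
  refine he.resolve_right fun he => hab.ne ?_
  rw [h.1.eq_of_mem_support_append ha (B.fst_mem_support_of_mem_edges he),
    h.1.eq_of_mem_support_append hb (B.snd_mem_support_of_mem_edges he)]

theorem isInducedPath_of_append_right {x y z : V} {A : G.Walk x y} {B : G.Walk y z}
    (h : IsInducedPath G (A.append B)) : IsInducedPath G B := by
  have h' := isInducedPath_reverse h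
  rw [reverse_append] at h'
  simpa using isInducedPath_reverse (isInducedPath_of_append_left h')

/-- Prepending a vertex whose only neighbour on an induced path is its start
keeps the path induced. -/
theorem isInducedPath_cons {s x y : V} {A : G.Walk x y} (h : IsInducedPath G A)
    (hsx : G.Adj s x) (hs : s ∉ A.support) (huniq : ∀ a ∈ A.support, G.Adj s a → a = x) :
    IsInducedPath G (cons hsx A) := by
  refine ⟨h.1.cons hs, fun a ha b hb hab => ?_⟩
  rw [support_cons, List.mem_cons] at ha hb
  rw [edges_cons, List.mem_cons]
  rcases ha with rfl | ha <;> rcases hb with rfl | hb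
  · exact absurd rfl hab.ne
  · exact Or.inl (by rw [huniq b hb hab])
  · exact Or.inl (by rw [huniq a ha hab.symm, Sym2.eq_swap])
  · exact Or.inr (h.2 a ha b hb hab)

/-- A path in which both ends are joined to the same vertex by edges of the path has length two. -/
theorem IsPath.length_eq_two {s t q : V} {A : G.Walk s t} (hA : A.IsPath)
    (hsq : s(s, q) ∈ A.edges) (hqt : s(q, t) ∈ A.edges) : A.length = 2 := by
  have hs := A.adj_of_mem_edges hsq
  have ht := A.adj_of_mem_edges hqt
  obtain ⟨A₁, A₂, h₁, h₂, rfl⟩ :=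
    hA.mem_support_iff_exists_append.1 (A.snd_mem_support_of_mem_edges hsq)
  rw [edges_append, List.mem_append] at hsq hqt
  have e₁ := h₁.length_eq_one_of_mem_edges <| hsq.resolve_right fun h =>
    hs.ne (hA.eq_of_mem_support_append A₁.start_mem_support (A₂.fst_mem_support_of_mem_edges h))
  have e₂ := h₂.length_eq_one_of_mem_edges <| hqt.resolve_left fun h =>
    ht.ne (hA.eq_of_mem_support_append (A₁.snd_mem_support_of_mem_edges h)
      A₂.end_mem_support).symm
  rw [length_append, e₁, e₂]

/-- A vertex off a path adjacent to both of its distinct ends closes a cycle. -/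
theorem IsPath.girth_le_length_add_two {a b p : V} {A : G.Walk a b} (hA : A.IsPath)
    (hab : a ≠ b) (hp : p ∉ A.support) (hpa : G.Adj p a) (hpb : G.Adj p b) :
    G.girth ≤ A.length + 2 := by
  have hc : (cons hpa (A.concat hpb.symm)).IsCycle := by
    rw [cons_isCycle_iff]
    refine ⟨hA.concat hp _, fun h => ?_⟩
    rw [edges_concat, List.concat_eq_append, List.mem_append, List.mem_singleton] at h
    rcases h with h | h
    · exact hp (A.fst_mem_support_of_mem_edges h)
    · rw [Sym2.eq_swap, Sym2.congr_left] at h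
      exact hab h
  simpa using girth_le_length hc

/-- Any two distinct vertices of a cycle split it into two arcs. -/
theorem IsCycle.exists_arcsOf {v s t : V} {w : G.Walk v v} (hw : w.IsCycle)
    (hs : s ∈ w.support) (ht : t ∈ w.support) (hst : s ≠ t) :
    ∃ A B : G.Walk s t, ArcsOf G w A B ∧ A.length + B.length = w.length ∧
      (∀ a, a ∈ w.support ↔ a ∈ A.support ∨ a ∈ B.support) := by
  classical
  have hc := (isCycle_rotate hs).2 hw
  have hmem : ∀ a, a ∈ (w.rotate s hs).support ↔ a ∈ w.support := fun a => by
    simp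
  have hedge : ∀ e, e ∈ (w.rotate s hs).edges ↔ e ∈ w.edges := fun e =>
    (w.rotate_edges s hs).perm.mem_iff
  have hlen := w.length_rotate s hs
  generalize w.rotate s hs = c at hc hmem hedge hlen
  obtain ⟨A, B, rfl⟩ := mem_support_iff_exists_append.1 ((hmem t).2 ht)
  have hA : A.IsPath := hc.isPath_of_append_left fun h => hst h.eq.symm
  have hB : B.IsPath := hc.isPath_of_append_right fun h => hst h.eq
  have hnd := hc.support_nodup
  rw [tail_support_append, List.nodup_append'] at hnd
  refine ⟨A, B.reverse, ⟨hs, ht, hst, hA, hB.reverse, ?_, ?_⟩, ?_, fun a => ?_⟩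
  · ext a
    simp only [Set.mem_inter_iff, Set.mem_ofPred_eq, support_reverse, List.mem_reverse,
      Set.mem_insert_iff, Set.mem_singleton_iff]
    constructor
    · rintro ⟨h₁, h₂⟩
      rw [mem_support_iff] at h₁ h₂
      rcases h₁ with h₁ | h₁
      · exact Or.inl h₁
      rcases h₂ with h₂ | h₂
      · exact Or.inr h₂
      exact absurd h₂ (hnd.2.2 h₁)
    · rintro (rfl | rfl) <;> simp
  · ext e
    simp [← hedge e]
  · rw [← hlen, length_append, length_reverse]
  · rw [← hmem a, mem_support_append_iff, support_reverse, List.mem_reverse]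

end SimpleGraph.Walk

open SimpleGraph.Walk

variable {G : SimpleGraph V}

/-- If the girth is large compared with a cycle, a vertex outside the cycle has at most one
neighbour on it. -/
theorem unique_neighbor_on_cycle {v p s t : V} {w : G.Walk v v} (hw : w.IsCycle)
    (hlen : w.length + 4 < 2 * G.girth) (hp : p ∉ w.support)
    (hs : s ∈ w.support) (ht : t ∈ w.support) (hps : G.Adj p s) (hpt : G.Adj p t) : s = t := by
  by_contra hst
  obtain ⟨A, B, hAB, hl, hsup⟩ := hw.exists_arcsOf hs ht hst
  have h₁ := hAB.2.2.2.1.girth_le_length_add_two hst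
    (fun h => hp ((hsup p).2 (Or.inl h))) hps hpt
  have h₂ := hAB.2.2.2.2.1.girth_le_length_add_two hst
    (fun h => hp ((hsup p).2 (Or.inr h))) hps hpt
  omega

/-- In a graph of girth at least five, nonadjacent vertices have at most one common neighbour. -/
theorem unique_common_neighbor (hg : 4 < G.girth) {s t q r : V} (hst : s ≠ t)
    (hsq : G.Adj s q) (hqt : G.Adj q t) (hsr : G.Adj s r) (hrt : G.Adj r t) : q = r := by
  by_contra hqr
  have hA : (cons hsr (cons hrt nil)).IsPath := by
    simp [cons_isPath_iff, hrt.ne, hsr.ne, hst]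
  have := hA.girth_le_length_add_two hst (p := q) (by simp [hsq.ne', hqr, hqt.ne]) hsq.symm hqt
  simp at this
  omega

/-- `R` is an induced path off `w` whose ends attach to nonadjacent vertices `s`, `t` of `w`. -/
structure IsConnector {v x y : V} (w : G.Walk v v) (s t : V) (R : G.Walk x y) : Prop where
  start_mem : s ∈ w.support
  end_mem : t ∈ w.support
  ne : s ≠ t
  not_adj : ¬ G.Adj s t
  adj_start : G.Adj s x
  adj_end : G.Adj y t
  induced : IsInducedPath G R
  off : ∀ a ∈ R.support, a ∉ w.support

/-- Removing the two ends of a jump leaves a connector. -/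
theorem IsJump.exists_isConnector {v s t : V} {w : G.Walk v v} {P : G.Walk s t}
    (hP : IsJump G w P) :
    ∃ (x y : V) (R : G.Walk x y), IsConnector w s t R ∧ ∀ a ∈ R.support, a ∈ P.support := by
  obtain ⟨-, hs, ht, hst, hadj, hind, hoff⟩ := hP
  cases P with
  | nil => exact absurd rfl hst
  | @cons _ x _ hsx P₁ =>
    obtain ⟨y, R, hyt, rfl⟩ : ∃ (y : V) (R : G.Walk x y) (h : G.Adj y t), P₁ = R.concat h := by
      cases P₁ with
      | nil => exact absurd hsx hadj
      | cons h p => exact exists_cons_eq_concat h p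
    have h₁ : IsInducedPath G (R.concat hyt) :=
      isInducedPath_of_append_right (A := cons hsx nil) (by simpa using hind)
    have h₂ : IsInducedPath G R :=
      isInducedPath_of_append_left (B := cons hyt nil) (by simpa [concat_eq_append] using h₁)
    have hsR := ((cons_isPath_iff _ _).1 hind.1).2
    have htR := ((concat_isPath_iff _).1 h₁.1).2
    have hsub : ∀ a ∈ R.support, a ∈ (cons hsx (R.concat hyt)).support := fun a ha => by
      simp [support_concat, ha]
    refine ⟨x, y, R, ⟨hs, ht, hst, hadj, hsx, hyt, h₂, fun a ha => hoff a ⟨hsub a ha, ?_, ?_⟩⟩, hsub⟩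
    · rintro rfl
      exact hsR (by simp [support_concat, ha])
    · rintro rfl
      exact htR ha

/-- Among connectors inside a given vertex set, choose one of minimum length: every other
attachment between it and `w` is a common neighbour of the ends. -/
theorem IsConnector.exists_minimal {v s t x y : V} {w : G.Walk v v} {R : G.Walk x y}
    (hR : IsConnector w s t R)
    (huniq : ∀ a c d, a ∉ w.support → c ∈ w.support → d ∈ w.support →
      G.Adj a c → G.Adj a d → c = d) :
    ∃ (s' t' x' y' : V) (R' : G.Walk x' y'), IsConnector w s' t' R' ∧
      (∀ a ∈ R'.support, a ∈ R.support) ∧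
      ∀ a ∈ R'.support, ∀ c ∈ w.support, G.Adj a c →
        (c = s' ∧ a = x') ∨ (c = t' ∧ a = y') ∨ (G.Adj s' c ∧ G.Adj c t') := by
  induction hn : R.length using Nat.strong_induction_on generalizing s t x y with
  | _ n ih =>
    subst hn
    by_cases hgood : ∀ a ∈ R.support, ∀ c ∈ w.support, G.Adj a c →
        (c = s ∧ a = x) ∨ (c = t ∧ a = y) ∨ (G.Adj s c ∧ G.Adj c t)
    · exact ⟨s, t, x, y, R, hR, fun _ => id, hgood⟩
    push Not at hgood
    obtain ⟨a, ha, c, hc, hac, hcs, hct, hno⟩ := hgood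
    have hoff := hR.off a ha
    have hax : a ≠ x := by
      rintro rfl
      exact hcs (huniq a c s hoff hc hR.start_mem hac hR.adj_start.symm) rfl
    have hay : a ≠ y := by
      rintro rfl
      exact hct (huniq a c t hoff hc hR.end_mem hac hR.adj_end) rfl
    obtain ⟨A, B, rfl⟩ := mem_support_iff_exists_append.1 ha
    have hA := isInducedPath_of_append_left hR.induced
    have hB := isInducedPath_of_append_right hR.induced
    have hsubA : ∀ b ∈ A.support, b ∈ (A.append B).support := fun b hb => by
      simp [mem_support_append_iff, hb]
    have hsubB : ∀ b ∈ B.support, b ∈ (A.append B).support := fun b hb => by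
      simp [mem_support_append_iff, hb]
    have hposA : A.length ≠ 0 := fun h => hax (eq_of_length_eq_zero h).symm
    have hposB : B.length ≠ 0 := fun h => hay (eq_of_length_eq_zero h)
    by_cases hleft : s ≠ c ∧ ¬ G.Adj s c
    · obtain ⟨s', t', x', y', R', h₁, h₂, h₃⟩ := ih A.length (by rw [length_append]; omega)
        (s := s) (t := c) (R := A) ⟨hR.start_mem, hc, hleft.1, hleft.2, hR.adj_start, hac, hA,
          fun b hb => hR.off b (hsubA b hb)⟩ rfl
      exact ⟨s', t', x', y', R', h₁, fun b hb => hsubA b (h₂ b hb), h₃⟩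
    · have hright : c ≠ t ∧ ¬ G.Adj c t := by
        by_cases hsc : s = c
        · subst hsc
          exact ⟨hR.ne, hR.not_adj⟩
        · have hadj : G.Adj s c := by
            by_contra h
            exact hleft ⟨hsc, h⟩
          refine ⟨?_, hno hadj⟩
          rintro rfl
          exact hR.not_adj hadj
      obtain ⟨s', t', x', y', R', h₁, h₂, h₃⟩ := ih B.length (by rw [length_append]; omega)
        (s := c) (t := t) (R := B) ⟨hc, hR.end_mem, hright.1, hright.2, hac.symm, hR.adj_end, hB,
          fun b hb => hR.off b (hsubB b hb)⟩ rfl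
      exact ⟨s', t', x', y', R', h₁, fun b hb => hsubB b (h₂ b hb), h₃⟩

/-- Adding the attachments to a connector whose ends attach nowhere else on the connector
gives a jump. -/
theorem IsConnector.exists_isJump {v s t x y : V} {w : G.Walk v v} {R : G.Walk x y}
    (hR : IsConnector w s t R) (hw : IsHole G w)
    (hs : ∀ a ∈ R.support, G.Adj s a → a = x) (ht : ∀ a ∈ R.support, G.Adj t a → a = y) :
    ∃ P : G.Walk s t, IsJump G w P ∧ (∀ a ∈ P.support, a = s ∨ a = t ∨ a ∈ R.support) := by
  have hsR : s ∉ R.support := fun h => hR.off s h hR.start_mem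
  have htR : t ∉ R.support := fun h => hR.off t h hR.end_mem
  have h₁ : IsInducedPath G (cons hR.adj_end.symm R.reverse) :=
    isInducedPath_cons (isInducedPath_reverse hR.induced) _ (by simpa using htR)
      (by simpa using ht)
  have h₂ := isInducedPath_reverse h₁
  have hmem : ∀ a, a ∈ (cons hR.adj_end.symm R.reverse).reverse.support ↔
      a ∈ R.support ∨ a = t := fun a => by
    rw [support_reverse, List.mem_reverse, support_cons, List.mem_cons, support_reverse,
      List.mem_reverse, or_comm]
  refine ⟨cons hR.adj_start (cons hR.adj_end.symm R.reverse).reverse,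
    ⟨hw, hR.start_mem, hR.end_mem, hR.ne, hR.not_adj,
      isInducedPath_cons h₂ _ ?_ ?_, ?_⟩, ?_⟩
  · rw [hmem]
    exact fun h => h.elim hsR hR.ne
  · intro a ha hsa
    rcases (hmem a).1 ha with ha | rfl
    · exact hs a ha hsa
    · exact absurd hsa hR.not_adj
  · rintro a ⟨ha, has, hat⟩
    rw [support_cons, List.mem_cons, hmem] at ha
    exact hR.off a ((ha.resolve_left has).resolve_right hat)
  · intro a ha
    rw [support_cons, List.mem_cons, hmem] at ha
    tauto

/-- A jump whose only attachment besides its ends is a common neighbour of the ends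
is a local jump across one vertex. -/
theorem IsJump.isLocalJumpAcrossOne {v s t q : V} {w : G.Walk v v} {P : G.Walk s t}
    (hP : IsJump G w P) (hq : q ∈ w.support) (hsq : G.Adj s q) (hqt : G.Adj q t)
    (hatt : ∃ b ∈ wInterior P, G.Adj q b)
    (honly : ∀ a ∈ w.support, a ≠ s → a ≠ t → ∀ b ∈ wInterior P, G.Adj a b → a = q) :
    IsLocalJumpAcrossOne G w P := by
  have key : ∀ A B : G.Walk s t, ArcsOf G w A B → (∀ a ∈ B.support, a ∈ w.support) →
      q ∈ A.support → IsLocalJumpAcrossOne G w P := by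
    intro A B hAB hBw hqA
    have hqB : q ∉ B.support := fun hqB => by
      have : q ∈ ({s, t} : Set V) := hAB.2.2.2.2.2.1 ▸ ⟨hqA, hqB⟩
      rcases this with h | h
      · exact hsq.ne h.symm
      · exact hqt.ne h
    have hedge : ∀ e, e ∈ w.edges → e ∈ A.edges ∨ e ∈ B.edges := fun e he => by
      have : e ∈ {e | e ∈ w.edges} := he
      rwa [hAB.2.2.2.2.2.2] at this
    have e₁ := (hedge _ (hP.1.2.2 s hP.2.1 q hq hsq)).resolve_right
      fun h => hqB (B.snd_mem_support_of_mem_edges h)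
    have e₂ := (hedge _ (hP.1.2.2 q hq t hP.2.2.1 hqt)).resolve_right
      fun h => hqB (B.fst_mem_support_of_mem_edges h)
    refine ⟨A, B, ⟨hP, hAB, ⟨q, ⟨hqA, hsq.ne', hqt.ne⟩, hatt⟩, ?_⟩,
      hAB.2.2.2.1.length_eq_two e₁ e₂⟩
    rintro a ⟨ha, has, hat⟩ b hb hab
    exact hqB (honly a (hBw a ha) has hat b hb hab ▸ ha)
  obtain ⟨A, B, hAB, -, hsup⟩ := hP.1.1.exists_arcsOf hP.2.1 hP.2.2.1 hP.2.2.2.1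
  rcases (hsup q).1 hq with h | h
  · exact key A B hAB (fun a ha => (hsup a).2 (Or.inr ha)) h
  · obtain ⟨h₁, h₂, h₃, h₄, h₅, h₆, h₇⟩ := hAB
    exact key B A ⟨h₁, h₂, h₃, h₅, h₄, by rw [Set.inter_comm, h₆], by rw [h₇, Set.union_comm]⟩
      (fun a ha => (hsup a).2 (Or.inl ha)) h

/-- If `P` is a local `(v1,v2)`-jump over the odd hole `w`, then
`G[V(C ∪ P)]` contains a local jump over `w` across one vertex or a short jump
over `w`. -/
theorem local_jump_gives_one_vertex_or_short_jump {V : Type*} [Fintype V]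
    (l : ℕ) (hl : 4 ≤ l) (G : SimpleGraph V) (hG : MemGFam G l)
    {v v1 v2 : V} (w : G.Walk v v) (hw : IsOddHole G w)
    (P : G.Walk v1 v2) (hloc : IsLocalJump G w P) :
    ∃ (s' t' : V) (P' : G.Walk s' t'),
      (IsLocalJumpAcrossOne G w P' ∨ IsShortJump G w P') ∧
      ∀ a ∈ P'.support, a ∈ w.support ∨ a ∈ P.support := by
  obtain ⟨Q₁, Q₂, hjump, -⟩ := hloc
  obtain ⟨hhole, k, hk⟩ := hw
  have hgirth : G.girth = 2 * l + 1 := hG.1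
  have hlen := hG.2 v w ⟨hhole, k, hk⟩
  obtain ⟨x₀, y₀, R₀, hR₀, hsub₀⟩ := hjump.exists_isConnector
  have huniq : ∀ a c d, a ∉ w.support → c ∈ w.support → d ∈ w.support →
      G.Adj a c → G.Adj a d → c = d := fun a c d ha hc hd =>
    unique_neighbor_on_cycle hhole.1 (by omega) ha hc hd
  obtain ⟨s, t, x, y, R, hR, hsub, hatt⟩ := hR₀.exists_minimal huniq
  obtain ⟨P', hP', hsup⟩ := hR.exists_isJump hhole
    (fun a ha hsa => by
      rcases hatt a ha s hR.start_mem hsa.symm with h | h | h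
      · exact h.2
      · exact absurd h.1 hR.ne
      · exact absurd h.1 (SimpleGraph.irrefl G))
    (fun a ha hta => by
      rcases hatt a ha t hR.end_mem hta.symm with h | h | h
      · exact absurd h.1.symm hR.ne
      · exact h.2
      · exact absurd h.2 (SimpleGraph.irrefl G))
  have hint : ∀ a ∈ w.support, a ≠ s → a ≠ t → ∀ b ∈ wInterior P', G.Adj a b →
      G.Adj s a ∧ G.Adj a t := by
    rintro a ha has hat b ⟨hb, hbs, hbt⟩ hab
    have hbR := ((hsup b hb).resolve_left hbs).resolve_left hbt
    rcases hatt b hbR a ha hab.symm with h | h | h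
    · exact absurd h.1 has
    · exact absurd h.1 hat
    · exact h
  refine ⟨s, t, P', ?_, fun a ha => ?_⟩
  · by_cases hshort : ∀ a ∈ w.support, a ≠ s → a ≠ t → ∀ b ∈ wInterior P', ¬ G.Adj a b
    · exact Or.inr ⟨hP', hshort⟩
    · push Not at hshort
      obtain ⟨q, hq, hqs, hqt, b, hb, hqb⟩ := hshort
      obtain ⟨h₁, h₂⟩ := hint q hq hqs hqt b hb hqb
      refine Or.inl (hP'.isLocalJumpAcrossOne hq h₁ h₂ ⟨b, hb, hqb⟩ ?_)
      intro a ha has hat c hc hac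
      obtain ⟨h₃, h₄⟩ := hint a ha has hat c hc hac
      exact unique_common_neighbor (by omega) hR.ne h₃ h₄ h₁ h₂
  · rcases hsup a ha with rfl | rfl | h
    · exact Or.inl hR.start_mem
    · exact Or.inl hR.end_mem
    · exact Or.inr (hsub₀ a (hsub a h))
end
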